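/- arXiv:2110.15416 — 4 statements merged into one kernel-verified Lean document; each statement's English description precedes it below -/
import Mathlib

section
/- Let L(λ) be a pencil in the assumed block upper triangular form with diagonal blocks L_ℓ(λ), R(λ), L_r(λ). Then the columns of a polynomial matrix M(λ) form a minimal basis of the right nullspace of L_ℓ(λ) if and only if the columns of the block vector [M(λ); 0; 0] (padded with zero blocks conformal with the block columns of R and L_r) form a minimal basis of the right nullspace of L(λ). -/
open Polynomial Matrix

noncomputable section

/-- The matrix pencil `L₀ + λ L₁` viewed as a polynomial matrix. -/
def pencilMat {ι κ : Type*} (L0 L1 : Matrix ι κ ℂ) : Matrix ι κ (Polynomial ℂ) :=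
  Matrix.of fun i j => Polynomial.C (L0 i j) + Polynomial.X * Polynomial.C (L1 i j)

/-- Entrywise evaluation of a polynomial matrix at a point. -/
def evalMat {ι κ : Type*} (P : Matrix ι κ (Polynomial ℂ)) (μ : ℂ) : Matrix ι κ ℂ :=
  P.map fun p => p.eval μ

/-- A polynomial matrix viewed over the field ℂ(λ) of rational functions. -/
def toRat {ι κ : Type*} (P : Matrix ι κ (Polynomial ℂ)) : Matrix ι κ (RatFunc ℂ) :=
  P.map (algebraMap (Polynomial ℂ) (RatFunc ℂ))

/-- The normal rank of a polynomial matrix: its rank over ℂ(λ). -/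
def normalRank {ι κ : Type*} [Fintype κ] (P : Matrix ι κ (Polynomial ℂ)) : ℕ :=
  (toRat P).rank

/-- The right nullspace of a polynomial matrix, as a ℂ(λ)-subspace of ℂ(λ)^κ. -/
def rightNullspace {ι κ : Type*} [Fintype κ] (P : Matrix ι κ (Polynomial ℂ)) :
    Submodule (RatFunc ℂ) (κ → RatFunc ℂ) :=
  LinearMap.ker (toRat P).mulVecLin

/-- The degree of a polynomial (column) vector: maximum of the degrees of its entries. -/
def colDegree {ι : Type*} [Fintype ι] (v : ι → Polynomial ℂ) : ℕ :=
  Finset.univ.sup fun i => (v i).natDegree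

/-- The columns of the polynomial matrix `N` form a minimal polynomial basis of the right
nullspace of `P`: they are a ℂ(λ)-basis of `rightNullspace P` and the sum of the column
degrees is minimal among all polynomial bases. -/
def IsMinimalBasis {ι κ : Type*} [Fintype ι] [Fintype κ] (P : Matrix ι κ (Polynomial ℂ))
    {p : ℕ} (N : Matrix κ (Fin p) (Polynomial ℂ)) : Prop :=
  LinearIndependent (RatFunc ℂ) (fun j : Fin p => fun i : κ => toRat N i j) ∧
  Submodule.span (RatFunc ℂ) (Set.range fun j : Fin p => fun i : κ => toRat N i j)
    = rightNullspace P ∧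
  ∀ M : Matrix κ (Fin p) (Polynomial ℂ),
    LinearIndependent (RatFunc ℂ) (fun j : Fin p => fun i : κ => toRat M i j) →
    Submodule.span (RatFunc ℂ) (Set.range fun j : Fin p => fun i : κ => toRat M i j)
      = rightNullspace P →
    (∑ j, colDegree fun i => N i j) ≤ ∑ j, colDegree fun i => M i j

/-- `x(λ)` is a right zero direction of order `k ≥ 1` for `P` at `λ₀`:
`x(λ₀) ≠ 0` and `P(λ)x(λ) = (λ-λ₀)^k v(λ)` with `v` defined and nonzero at `λ₀`. -/
def IsZeroDirection {ι κ : Type*} [Fintype κ] (P : Matrix ι κ (Polynomial ℂ)) (lam0 : ℂ)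
    (k : ℕ) (x : κ → Polynomial ℂ) : Prop :=
  0 < k ∧ (fun i => (x i).eval lam0) ≠ 0 ∧
  (∀ i, (Polynomial.X - Polynomial.C lam0) ^ k ∣ P.mulVec x i) ∧
  ¬ ∀ i, (Polynomial.X - Polynomial.C lam0) ^ (k + 1) ∣ P.mulVec x i

/-- `x(λ)` is a root polynomial of order (exactly) `k` at `λ₀` for `P`: it is a zero direction
of order `k` and, for every right minimal basis `N` of `P`, `[N(λ₀) x(λ₀)]` has full column
rank. -/
def IsRootPoly {ι κ : Type*} [Fintype ι] [Fintype κ] (P : Matrix ι κ (Polynomial ℂ)) (lam0 : ℂ)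
    (k : ℕ) (x : κ → Polynomial ℂ) : Prop :=
  IsZeroDirection P lam0 k x ∧
  ∀ (p : ℕ) (N : Matrix κ (Fin p) (Polynomial ℂ)), IsMinimalBasis P N →
    (Matrix.of fun (i : κ) (j : Sum (Fin p) (Fin 1)) =>
      Sum.elim (fun a => (N i a).eval lam0) (fun _ => (x i).eval lam0) j).rank = p + 1

/-- `r 0, …, r (s-1)` is a `λ₀`-independent set of root polynomials of orders `k 0, …, k (s-1)`
for `P`: each is a root polynomial and `[N(λ₀) r₁(λ₀) … r_s(λ₀)]` has full column rank for
every right minimal basis `N`. -/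
def IsIndepFamily {ι κ : Type*} [Fintype ι] [Fintype κ] (P : Matrix ι κ (Polynomial ℂ))
    (lam0 : ℂ) {s : ℕ} (k : Fin s → ℕ) (r : Fin s → κ → Polynomial ℂ) : Prop :=
  (∀ i, IsRootPoly P lam0 (k i) (r i)) ∧
  ∀ (p : ℕ) (N : Matrix κ (Fin p) (Polynomial ℂ)), IsMinimalBasis P N →
    (Matrix.of fun (i : κ) (j : Sum (Fin p) (Fin s)) =>
      Sum.elim (fun a => (N i a).eval lam0) (fun b => (r b i).eval lam0) j).rank = p + s

/-- A complete set of root polynomials: a `λ₀`-independent set such that no `λ₀`-independent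
set with more elements exists. -/
def IsCompleteFamily {ι κ : Type*} [Fintype ι] [Fintype κ] (P : Matrix ι κ (Polynomial ℂ))
    (lam0 : ℂ) {s : ℕ} (k : Fin s → ℕ) (r : Fin s → κ → Polynomial ℂ) : Prop :=
  IsIndepFamily P lam0 k r ∧
  ∀ (s' : ℕ) (k' : Fin s' → ℕ) (r' : Fin s' → κ → Polynomial ℂ),
    IsIndepFamily P lam0 k' r' → s' ≤ s

/-- A maximal set of root polynomials at `λ₀`: complete, ordered (`k₁ ≥ … ≥ k_s > 0`), and for
every `j` there is no root polynomial of order `> k j` that stays `λ₀`-independent together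
with `r₁, …, r_{j-1}`. -/
def IsMaximalFamily {ι κ : Type*} [Fintype ι] [Fintype κ] (P : Matrix ι κ (Polynomial ℂ))
    (lam0 : ℂ) {s : ℕ} (k : Fin s → ℕ) (r : Fin s → κ → Polynomial ℂ) : Prop :=
  IsCompleteFamily P lam0 k r ∧ Antitone k ∧ (∀ i, 0 < k i) ∧
  ∀ (j : Fin s) (k' : ℕ), k j < k' → ∀ x : κ → Polynomial ℂ, IsRootPoly P lam0 k' x →
    ¬ ∀ (p : ℕ) (N : Matrix κ (Fin p) (Polynomial ℂ)), IsMinimalBasis P N →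
      (Matrix.of fun (i : κ) (c : Sum (Fin p) (Fin ((j : ℕ) + 1))) =>
        Sum.elim (fun a => (N i a).eval lam0)
          (fun b => if h : (b : ℕ) < (j : ℕ) then (r ⟨(b : ℕ), h.trans j.isLt⟩ i).eval lam0
                    else (x i).eval lam0) c).rank = p + (j : ℕ) + 1

/-- `σ 0 ≤ … ≤ σ (r-1)` are the partial multiplicities of `P` at `λ₀`: there is a local Smith
form `M(λ) P(λ) N(λ) = diag((λ-λ₀)^{σ i}) ⊕ 0` (up to positioning of the diagonal) with `M`,
`N` polynomial and invertible at `λ₀`. -/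
def HasPartialMultiplicities {ι κ : Type*} [Fintype ι] [Fintype κ] [DecidableEq ι]
    [DecidableEq κ] (P : Matrix ι κ (Polynomial ℂ)) (lam0 : ℂ) {r : ℕ} (σ : Fin r → ℕ) : Prop :=
  Monotone σ ∧
  ∃ (M : Matrix ι ι (Polynomial ℂ)) (N : Matrix κ κ (Polynomial ℂ))
    (fR : Fin r → ι) (fC : Fin r → κ),
    Function.Injective fR ∧ Function.Injective fC ∧
    (evalMat M lam0).det ≠ 0 ∧ (evalMat N lam0).det ≠ 0 ∧
    M * P * N = Matrix.of fun i j =>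
      ∑ a : Fin r, if i = fR a ∧ j = fC a then (Polynomial.X - Polynomial.C lam0) ^ σ a else 0

/-- Every entry of the polynomial matrix has degree at most one, i.e. the matrix is a pencil. -/
def IsPencilMat {ι κ : Type*} (M : Matrix ι κ (Polynomial ℂ)) : Prop :=
  ∀ i j, (M i j).natDegree ≤ 1

/-- The block upper triangular matrix `[[Lℓ, A, B], [0, R, C], [0, 0, Lr]]`. -/
def blockTri {m1 m2 m3 n1 n3 : ℕ}
    (Ll : Matrix (Fin m1) (Fin n1) (Polynomial ℂ))
    (Am : Matrix (Fin m1) (Fin m2) (Polynomial ℂ))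
    (Bm : Matrix (Fin m1) (Fin n3) (Polynomial ℂ))
    (Rm : Matrix (Fin m2) (Fin m2) (Polynomial ℂ))
    (Cm : Matrix (Fin m2) (Fin n3) (Polynomial ℂ))
    (Lr : Matrix (Fin m3) (Fin n3) (Polynomial ℂ)) :
    Matrix (Fin m1 ⊕ Fin m2 ⊕ Fin m3) (Fin n1 ⊕ Fin m2 ⊕ Fin n3) (Polynomial ℂ) :=
  Matrix.of fun r c =>
    match r, c with
    | Sum.inl i, Sum.inl j => Ll i j
    | Sum.inl i, Sum.inr (Sum.inl j) => Am i j
    | Sum.inl i, Sum.inr (Sum.inr j) => Bm i j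
    | Sum.inr (Sum.inl _), Sum.inl _ => 0
    | Sum.inr (Sum.inl i), Sum.inr (Sum.inl j) => Rm i j
    | Sum.inr (Sum.inl i), Sum.inr (Sum.inr j) => Cm i j
    | Sum.inr (Sum.inr _), Sum.inl _ => 0
    | Sum.inr (Sum.inr _), Sum.inr (Sum.inl _) => 0
    | Sum.inr (Sum.inr i), Sum.inr (Sum.inr j) => Lr i j

/-- A square polynomial matrix with nonzero determinant has trivial rational right nullspace. -/
theorem eq_zero_of_toRat_mulVec_eq_zero {n : ℕ} {P : Matrix (Fin n) (Fin n) ℂ[X]}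
    (hP : P.det ≠ 0) {x : Fin n → RatFunc ℂ} (hx : toRat P *ᵥ x = 0) : x = 0 := by
  refine Matrix.eq_zero_of_mulVec_eq_zero ?_ hx
  have h : (toRat P).det = algebraMap ℂ[X] (RatFunc ℂ) P.det :=
    (RingHom.map_det (algebraMap ℂ[X] (RatFunc ℂ)) P).symm
  rw [h]
  exact (map_ne_zero_iff _ (IsFractionRing.injective ℂ[X] (RatFunc ℂ))).mpr hP

/-- A polynomial matrix with full column rank at some point has trivial rational right nullspace. -/
theorem toRat_mulVec_eq_zero_of_evalMat_rank {m n : ℕ} {P : Matrix (Fin m) (Fin n) ℂ[X]} {μ : ℂ}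
    (hP : (evalMat P μ).rank = n) {x : Fin n → RatFunc ℂ} (hx : toRat P *ᵥ x = 0) : x = 0 := by
  have hker : LinearMap.ker (evalMat P μ).mulVecLin = ⊥ := by
    have h := (evalMat P μ).mulVecLin.finrank_range_add_finrank_ker
    rw [← Matrix.rank, hP, Module.finrank_fin_fun] at h
    exact Submodule.finrank_eq_zero.mp (by omega)
  obtain ⟨g, hg⟩ := LinearMap.exists_leftInverse_of_injective _ hker
  let B : Matrix (Fin n) (Fin m) ℂ := LinearMap.toMatrix' g
  have hB : B * evalMat P μ = 1 := by
    rw [← LinearMap.toMatrix'_toLin' (evalMat P μ), ← LinearMap.toMatrix'_comp,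
      Matrix.toLin'_apply', hg, LinearMap.toMatrix'_id]
  have hmap : (evalRingHom μ).mapMatrix (B.map C * P) = 1 := by
    rw [← hB]
    ext i j
    simp [evalMat, Matrix.mul_apply, eval_finsetSum]
  have hdet : (B.map C * P).det ≠ 0 := by
    intro h
    have h' := RingHom.map_det (evalRingHom μ) (B.map C * P)
    rw [h, hmap] at h'
    simp at h'
  have hmul : toRat (B.map C * P) = toRat (B.map C) * toRat P := by
    simp only [toRat, Matrix.map_mul]
  refine eq_zero_of_toRat_mulVec_eq_zero hdet ?_
  rw [hmul, ← Matrix.mulVec_mulVec, hx, Matrix.mulVec_zero]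

/-- Padding a vector by zeros, as a linear map. -/
def padLin (K : Type*) [Semiring K] (α β : Type*) : (α → K) →ₗ[K] (α ⊕ β → K) where
  toFun v := Sum.elim v 0
  map_add' u v := by ext (i | i) <;> simp
  map_smul' c v := by ext (i | i) <;> simp

theorem ker_padLin (K : Type*) [Semiring K] (α β : Type*) :
    LinearMap.ker (padLin K α β) = ⊥ :=
  LinearMap.ker_eq_bot'.mpr fun _ h => funext fun i => congrFun h (Sum.inl i)

theorem toRat_pad_cols {α β : Type*} {p : ℕ} (M : Matrix α (Fin p) ℂ[X]) :
    (fun j : Fin p => fun i => toRat (Matrix.of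
      fun (c : α ⊕ β) j => Sum.elim (fun i => M i j) (fun _ => 0) c) i j)
      = padLin (RatFunc ℂ) α β ∘ fun j : Fin p => fun i => toRat M i j := by
  ext j (i | i) <;> simp [toRat, padLin]

theorem colDegree_sumElim_zero {α β : Type*} [Fintype α] [Fintype β] (v : α → ℂ[X]) :
    colDegree (Sum.elim v (fun _ : β => 0)) = colDegree v := by
  apply le_antisymm
  · refine Finset.sup_le ?_
    rintro (i | i) -
    · exact Finset.le_sup (f := fun i => (v i).natDegree) (Finset.mem_univ i)
    · simp
  · exact Finset.sup_le fun i _ => Finset.le_sup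
      (f := fun i => (Sum.elim v (fun _ : β => 0) i).natDegree) (Finset.mem_univ (Sum.inl i))

/-- If the right nullspace of `Q` is the zero-padded right nullspace of `P`, then minimal bases
of the two nullspaces correspond under zero padding. -/
theorem isMinimalBasis_pad_iff {ι ι' α β : Type*} [Fintype ι] [Fintype ι'] [Fintype α] [Fintype β]
    {P : Matrix ι α ℂ[X]} {Q : Matrix ι' (α ⊕ β) ℂ[X]}
    (hQ : rightNullspace Q = (rightNullspace P).map (padLin (RatFunc ℂ) α β))
    {p : ℕ} (M : Matrix α (Fin p) ℂ[X]) :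
    IsMinimalBasis P M ↔
      IsMinimalBasis Q (Matrix.of fun c j => Sum.elim (fun i => M i j) (fun _ => 0) c) := by
  have hindep : ∀ N : Matrix α (Fin p) ℂ[X],
      LinearIndependent (RatFunc ℂ) (fun j : Fin p => fun i => toRat (Matrix.of
        fun (c : α ⊕ β) j => Sum.elim (fun i => N i j) (fun _ => 0) c) i j) ↔
      LinearIndependent (RatFunc ℂ) (fun j : Fin p => fun i => toRat N i j) := fun N => by
    rw [toRat_pad_cols]
    exact LinearMap.linearIndependent_iff _ (ker_padLin _ _ _)
  have hspan : ∀ N : Matrix α (Fin p) ℂ[X],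
      Submodule.span (RatFunc ℂ) (Set.range fun j : Fin p => fun i => toRat (Matrix.of
        fun (c : α ⊕ β) j => Sum.elim (fun i => N i j) (fun _ => 0) c) i j)
        = rightNullspace Q ↔
      Submodule.span (RatFunc ℂ) (Set.range fun j : Fin p => fun i => toRat N i j)
        = rightNullspace P := fun N => by
    rw [toRat_pad_cols, hQ, Set.range_comp, Submodule.span_image]
    exact (Submodule.map_injective_of_injective
      (LinearMap.ker_eq_bot.mp (ker_padLin _ _ _))).eq_iff
  have hdeg : ∀ (N : Matrix α (Fin p) ℂ[X]) (j : Fin p),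
      colDegree (fun i => (Matrix.of fun (c : α ⊕ β) j =>
        Sum.elim (fun i => N i j) (fun _ => 0) c) i j) = colDegree (fun i => N i j) :=
    fun N j => colDegree_sumElim_zero _
  unfold IsMinimalBasis
  rw [hindep, hspan]
  simp only [hdeg]
  refine and_congr_right fun _ => and_congr_right fun _ => ⟨fun h N hN hN' => ?_,
    fun h N hN hN' => ?_⟩
  · obtain ⟨N₀, rfl⟩ : ∃ N₀ : Matrix α (Fin p) ℂ[X],
        N = Matrix.of fun c j => Sum.elim (fun i => N₀ i j) (fun _ => 0) c := by
      refine ⟨Matrix.of fun i j => N (Sum.inl i) j, ?_⟩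
      ext1 (i | i) j
      · rfl
      · have hmem : (fun i => toRat N i j) ∈ rightNullspace Q :=
          hN' ▸ Submodule.subset_span ⟨j, rfl⟩
        rw [hQ] at hmem
        obtain ⟨y, -, hy⟩ := hmem
        have h0 : (algebraMap ℂ[X] (RatFunc ℂ)) (N (Sum.inr i) j) = 0 :=
          (congrFun hy (Sum.inr i)).symm
        exact (map_eq_zero_iff _ (IsFractionRing.injective ℂ[X] (RatFunc ℂ))).mp h0
    simp only [hdeg]
    exact h N₀ ((hindep N₀).mp hN) ((hspan N₀).mp hN')
  · simpa only [hdeg] using h _ ((hindep N).mpr hN) ((hspan N).mpr hN')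

/-- The right nullspace of a block upper triangular matrix whose two trailing diagonal blocks have
trivial right nullspaces. -/
theorem rightNullspace_blockTri {m1 m2 m3 n1 n3 : ℕ}
    (Ll : Matrix (Fin m1) (Fin n1) ℂ[X]) (Am : Matrix (Fin m1) (Fin m2) ℂ[X])
    (Bm : Matrix (Fin m1) (Fin n3) ℂ[X]) (Rm : Matrix (Fin m2) (Fin m2) ℂ[X])
    (Cm : Matrix (Fin m2) (Fin n3) ℂ[X]) (Lr : Matrix (Fin m3) (Fin n3) ℂ[X])
    (hR : ∀ x, toRat Rm *ᵥ x = 0 → x = 0) (hLr : ∀ x, toRat Lr *ᵥ x = 0 → x = 0) :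
    rightNullspace (blockTri Ll Am Bm Rm Cm Lr) =
      (rightNullspace Ll).map (padLin (RatFunc ℂ) (Fin n1) (Fin m2 ⊕ Fin n3)) := by
  ext x
  simp only [rightNullspace, Submodule.mem_map, LinearMap.mem_ker, Matrix.mulVecLin_apply]
  constructor
  · intro hx
    have h3 : (fun j => x (Sum.inr (Sum.inr j))) = 0 := hLr _ <| funext fun i => by
      simpa [Matrix.mulVec, dotProduct, toRat, blockTri] using congrFun hx (Sum.inr (Sum.inr i))
    have h3' : ∀ j, x (Sum.inr (Sum.inr j)) = 0 := congrFun h3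
    have h2 : (fun j => x (Sum.inr (Sum.inl j))) = 0 := hR _ <| funext fun i => by
      simpa [Matrix.mulVec, dotProduct, toRat, blockTri, h3'] using
        congrFun hx (Sum.inr (Sum.inl i))
    have h2' : ∀ j, x (Sum.inr (Sum.inl j)) = 0 := congrFun h2
    refine ⟨fun j => x (Sum.inl j), funext fun i => ?_, ?_⟩
    · simpa [Matrix.mulVec, dotProduct, toRat, blockTri, h3', h2'] using congrFun hx (Sum.inl i)
    · ext (i | i | i)
      · rfl
      · exact (h2' i).symm
      · exact (h3' i).symm
  · rintro ⟨y, hy, rfl⟩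
    ext (i | i | i)
    · simpa [Matrix.mulVec, dotProduct, toRat, blockTri, padLin] using congrFun hy i
    · simp [Matrix.mulVec, dotProduct, toRat, blockTri, padLin]
    · simp [Matrix.mulVec, dotProduct, toRat, blockTri, padLin]

/-- Proposition on minimal bases of block triangular pencils. Let
`L(λ) = [[Lℓ, A, B], [0, R, C], [0, 0, Lr]]` be a pencil where `Lℓ` is right invertible over
`ℂ[λ]`, `R` is regular with `λ₀` as its only finite eigenvalue, and `Lr` has no eigenvalue at
`λ₀` and no right minimal indices. Then `M(λ)` is a right minimal basis of `Lℓ` iff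
`[M(λ); 0; 0]` is a right minimal basis of `L`. -/
theorem minimal_basis_of_block_triangular
    {m1 m2 m3 n1 n3 : ℕ} (lam0 : ℂ)
    (Ll : Matrix (Fin m1) (Fin n1) (Polynomial ℂ))
    (Am : Matrix (Fin m1) (Fin m2) (Polynomial ℂ))
    (Bm : Matrix (Fin m1) (Fin n3) (Polynomial ℂ))
    (Rm : Matrix (Fin m2) (Fin m2) (Polynomial ℂ))
    (Cm : Matrix (Fin m2) (Fin n3) (Polynomial ℂ))
    (Lr : Matrix (Fin m3) (Fin n3) (Polynomial ℂ))
    (hLl : IsPencilMat Ll) (hAm : IsPencilMat Am) (hBm : IsPencilMat Bm)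
    (hRm : IsPencilMat Rm) (hCm : IsPencilMat Cm) (hLr : IsPencilMat Lr)
    -- `Lℓ` is right invertible over ℂ[λ]
    (hLlinv : ∃ Rinv : Matrix (Fin n1) (Fin m1) (Polynomial ℂ), Ll * Rinv = 1)
    -- `R` is regular and its only finite eigenvalue is `λ₀`
    (hRreg : ∃ (c : ℂ) (d : ℕ), c ≠ 0 ∧
      Rm.det = Polynomial.C c * (Polynomial.X - Polynomial.C lam0) ^ d)
    -- `Lr` has no eigenvalue at `λ₀` and no right minimal indices
    (hLr0 : (evalMat Lr lam0).rank = n3) :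
    ∀ (p : ℕ) (M : Matrix (Fin n1) (Fin p) (Polynomial ℂ)),
      IsMinimalBasis Ll M ↔
      IsMinimalBasis (blockTri Ll Am Bm Rm Cm Lr)
        (Matrix.of fun c j => Sum.elim (fun i => M i j) (fun _ => 0) c) := by
  obtain ⟨c, d, hc, hdet⟩ := hRreg
  have hR : Rm.det ≠ 0 := by
    rw [hdet]
    exact mul_ne_zero (C_ne_zero.mpr hc) (pow_ne_zero _ (X_sub_C_ne_zero lam0))
  intro p M
  exact isMinimalBasis_pad_iff (rightNullspace_blockTri Ll Am Bm Rm Cm Lr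
    (fun _ => eq_zero_of_toRat_mulVec_eq_zero hR)
    (fun _ => toRat_mulVec_eq_zero_of_evalMat_rank hLr0)) M

end
end

section
/- Let L(λ) be a pencil in the assumed block upper triangular form with diagonal blocks L_ℓ(λ), R(λ), L_r(λ). Suppose v(λ)+(λ−λ_0)^ℓ z(λ) is a root polynomial of order ℓ at λ_0 for R(λ), where v(λ) is a polynomial vector of degree at most ℓ−1 and z(λ) is a polynomial vector. Then there exists a polynomial vector u(λ) such that q(λ)=[u(λ); v(λ); 0] is a root polynomial of order exactly ℓ at λ_0 for L(λ); one can take u(λ)=−L_ℓ(λ)^R A(λ) v(λ) for any polynomial right inverse L_ℓ(λ)^R of L_ℓ(λ), and in particular u(λ)=0 if A(λ)=0. -/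
open Polynomial Matrix

noncomputable section

theorem Matrix.rank_eq_card_iff {K ι κ : Type*} [Field K] [Fintype κ] (A : Matrix ι κ K) :
    A.rank = Fintype.card κ ↔ ∀ y, A *ᵥ y = 0 → y = 0 := by
  have h := A.mulVecLin.finrank_range_add_finrank_ker
  rw [Module.finrank_fintype_fun_eq_card] at h
  have hker : Module.finrank K (LinearMap.ker A.mulVecLin) = 0 ↔ ∀ y, A *ᵥ y = 0 → y = 0 := by
    rw [Submodule.finrank_eq_zero, LinearMap.ker_eq_bot']
    rfl
  rw [← hker, Matrix.rank]
  omega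

open scoped ComplexOrder in
/-- A polynomial matrix with full column rank at some point has trivial right kernel. -/
theorem eq_zero_of_mulVec_eq_zero_of_rank_evalMat {ι κ : Type*} [Fintype ι] [Fintype κ]
    {P : Matrix ι κ (Polynomial ℂ)} {μ : ℂ} (hP : (evalMat P μ).rank = Fintype.card κ)
    {w : κ → Polynomial ℂ} (hw : P *ᵥ w = 0) : w = 0 := by
  classical
  set A := evalMat P μ with hA
  have hdet : (Aᴴ * A).det ≠ 0 := by
    have hr : (Aᴴ * A).rank = Fintype.card κ := by rw [Matrix.rank_conjTranspose_mul_self, hP]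
    rw [Matrix.rank_eq_card_iff] at hr
    intro h0
    obtain ⟨y, hy, hy0⟩ := Matrix.exists_mulVec_eq_zero_iff.mpr h0
    exact hy (hr y hy0)
  have heval : (((Aᴴ).map Polynomial.C * P).map (Polynomial.evalRingHom μ)) = Aᴴ * A := by
    rw [Matrix.map_mul]
    congr 1
    ext i j
    simp
  refine Matrix.eq_zero_of_mulVec_eq_zero (M := (Aᴴ).map Polynomial.C * P) ?_ ?_
  · intro h0
    apply hdet
    rw [← heval, ← RingHom.mapMatrix_apply, ← RingHom.map_det, h0, map_zero]
  · rw [← Matrix.mulVec_mulVec, hw, Matrix.mulVec_zero]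

theorem mulVec_col_eq_zero_of_isMinimalBasis {ι κ : Type*} [Fintype ι] [Fintype κ]
    {P : Matrix ι κ (Polynomial ℂ)} {p : ℕ} {N : Matrix κ (Fin p) (Polynomial ℂ)}
    (hN : IsMinimalBasis P N) (j : Fin p) : P *ᵥ (fun i => N i j) = 0 := by
  have hmem : (fun i => toRat N i j) ∈ rightNullspace P :=
    hN.2.1 ▸ Submodule.subset_span ⟨j, rfl⟩
  have h0 : toRat P *ᵥ (fun i => toRat N i j) = 0 := hmem
  funext i
  apply RatFunc.algebraMap_injective ℂ
  rw [RingHom.map_mulVec, Pi.zero_apply, map_zero]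
  exact congrFun h0 i

/-- A minimal polynomial basis has full column rank at every point. -/
theorem eq_zero_of_evalMat_mulVec_eq_zero {ι κ : Type*} [Fintype ι] [Fintype κ]
    {P : Matrix ι κ (Polynomial ℂ)} {p : ℕ} {N : Matrix κ (Fin p) (Polynomial ℂ)}
    (hN : IsMinimalBasis P N) (μ : ℂ) (y : Fin p → ℂ) (hy : evalMat N μ *ᵥ y = 0) : y = 0 := by
  classical
  obtain ⟨hli, hspan, hmin⟩ := hN
  by_contra hne
  obtain ⟨k, hk⟩ : ∃ k, y k ≠ 0 := by
    by_contra! h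
    exact hne (funext h)
  obtain ⟨j, hj, hjmax⟩ := Finset.exists_max_image (Finset.univ.filter fun k => y k ≠ 0)
    (fun k => colDegree fun i => N i k) ⟨k, by simp [hk]⟩
  replace hj : y j ≠ 0 := by simpa using hj
  set d := colDegree fun i => N i j with hd
  set s : κ → Polynomial ℂ := fun i => ∑ k, Polynomial.C (y k) * N i k with hs
  have hdiv : ∀ i, Polynomial.X - Polynomial.C μ ∣ s i := by
    intro i
    rw [Polynomial.dvd_iff_isRoot, Polynomial.IsRoot.def]
    have := congrFun hy i
    simp only [Matrix.mulVec, dotProduct, evalMat, Matrix.map_apply, Pi.zero_apply] at this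
    simpa [hs, Polynomial.eval_finsetSum, mul_comm] using this
  choose t ht using hdiv
  have hsdeg : ∀ i, (s i).natDegree ≤ d := by
    intro i
    refine Polynomial.natDegree_sum_le_of_forall_le _ _ fun k _ => ?_
    by_cases hk0 : y k = 0
    · simp [hk0]
    · refine (Polynomial.natDegree_C_mul_le _ _).trans (le_trans ?_ (hjmax k (by simp [hk0])))
      exact Finset.le_sup (f := fun i => (N i k).natDegree) (Finset.mem_univ i)
  have htdeg : ∀ i, t i ≠ 0 → (t i).natDegree + 1 ≤ d := by
    intro i hi
    have h1 := hsdeg i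
    rw [ht i, Polynomial.natDegree_mul (Polynomial.X_sub_C_ne_zero μ) hi,
      Polynomial.natDegree_X_sub_C] at h1
    omega
  let ρ : Polynomial ℂ →+* RatFunc ℂ := algebraMap (Polynomial ℂ) (RatFunc ℂ)
  let n : Fin p → κ → RatFunc ℂ := fun k i => toRat N i k
  have hsrat : (fun i => ρ (s i)) = ∑ k, ρ (Polynomial.C (y k)) • n k := by
    funext i
    simp [hs, n, ρ, toRat]
  have hρ : ∀ {q : Polynomial ℂ}, q ≠ 0 → ρ q ≠ 0 := fun hq h =>
    hq (RatFunc.algebraMap_injective ℂ (by simpa [ρ] using h))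
  have hpos : 0 < d := by
    by_contra h0
    have hs0 : (fun i => ρ (s i)) = 0 := by
      funext i
      have : t i = 0 := by
        by_contra hti
        have := htdeg i hti
        omega
      simp [ht i, this]
    rw [hsrat] at hs0
    exact hρ (Polynomial.C_ne_zero.mpr hj) (Fintype.linearIndependent_iff.mp hli _ hs0 j)
  let M : Matrix κ (Fin p) (Polynomial ℂ) := Matrix.of fun i k => if k = j then t i else N i k
  let m : Fin p → κ → RatFunc ℂ := fun k i => toRat M i k
  have hmj : ρ (Polynomial.X - Polynomial.C μ) • m j = ∑ k, ρ (Polynomial.C (y k)) • n k := by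
    rw [← hsrat]
    funext i
    simp [m, M, toRat, ht, ρ]
  have hmk : ∀ k, k ≠ j → m k = n k := by
    intro k hkj
    funext i
    simp [m, n, M, toRat, hkj]
  have hle : ∀ k, m k ∈ Submodule.span (RatFunc ℂ) (Set.range n) := by
    intro k
    by_cases hkj : k = j
    · subst hkj
      rw [← Submodule.smul_mem_iff _ (hρ (Polynomial.X_sub_C_ne_zero μ)), hmj]
      exact Submodule.sum_mem _ fun k _ => Submodule.smul_mem _ _ (Submodule.subset_span ⟨k, rfl⟩)
    · rw [hmk k hkj]
      exact Submodule.subset_span ⟨k, rfl⟩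
  have hge : ∀ k, n k ∈ Submodule.span (RatFunc ℂ) (Set.range m) := by
    intro k
    by_cases hkj : k = j
    · subst hkj
      rw [← Submodule.smul_mem_iff _ (hρ (Polynomial.C_ne_zero.mpr hj))]
      rw [← Finset.add_sum_erase _ _ (Finset.mem_univ k)] at hmj
      rw [eq_sub_of_add_eq hmj.symm]
      refine Submodule.sub_mem _ (Submodule.smul_mem _ _ (Submodule.subset_span ⟨k, rfl⟩))
        (Submodule.sum_mem _ fun l hl => Submodule.smul_mem _ _ ?_)
      rw [← hmk l (Finset.ne_of_mem_erase hl)]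
      exact Submodule.subset_span ⟨l, rfl⟩
    · rw [← hmk k hkj]
      exact Submodule.subset_span ⟨k, rfl⟩
  have hspan' : Submodule.span (RatFunc ℂ) (Set.range m)
      = Submodule.span (RatFunc ℂ) (Set.range n) :=
    le_antisymm (Submodule.span_le.mpr (Set.range_subset_iff.mpr hle))
      (Submodule.span_le.mpr (Set.range_subset_iff.mpr hge))
  have hli' : LinearIndependent (RatFunc ℂ) m := by
    rw [linearIndependent_iff_card_eq_finrank_span, Set.finrank, hspan']
    exact linearIndependent_iff_card_eq_finrank_span.mp hli
  refine absurd (hmin M hli' (hspan'.trans hspan)) (not_le.mpr ?_)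
  have hlt : (colDegree fun i => M i j) < colDegree fun i => N i j := by
    refine (Finset.sup_lt_iff hpos).mpr fun i _ => ?_
    by_cases hti : t i = 0
    · simpa [M, hti] using hpos
    · simpa [M] using htdeg i hti
  refine Finset.sum_lt_sum (fun k _ => ?_) ⟨j, Finset.mem_univ j, hlt⟩
  by_cases hkj : k = j
  · exact hkj ▸ hlt.le
  · simp [M, hkj]

/-- For a regular pencil, the order of a zero direction survives truncation below that order. -/
theorem isZeroDirection_of_add_pow_mul {κ : Type*} [Fintype κ] [DecidableEq κ]
    {R : Matrix κ κ (Polynomial ℂ)} (hR : IsPencilMat R) (hdet : R.det ≠ 0) {μ : ℂ} {k : ℕ}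
    {v z : κ → Polynomial ℂ} (hv : ∀ i, (v i).natDegree ≤ k - 1)
    (h : IsZeroDirection R μ k (fun i => v i + (Polynomial.X - Polynomial.C μ) ^ k * z i)) :
    IsZeroDirection R μ k v := by
  obtain ⟨hk, hne, hdvd, -⟩ := h
  have hv0 : (fun i => (v i).eval μ) ≠ 0 := by
    intro h0
    apply hne
    funext i
    have := congrFun h0 i
    simp only [Pi.zero_apply] at this
    simp [this, hk.ne']
  refine ⟨hk, hv0, fun i => ?_, fun hall => ?_⟩
  · have hsplit : R *ᵥ (fun i => v i + (Polynomial.X - Polynomial.C μ) ^ k * z i)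
        = R *ᵥ v + (Polynomial.X - Polynomial.C μ) ^ k • R *ᵥ z := by
      rw [← Matrix.mulVec_smul, ← Matrix.mulVec_add]
      rfl
    have := hdvd i
    rw [hsplit, Pi.add_apply, Pi.smul_apply, smul_eq_mul] at this
    exact (dvd_add_left (dvd_mul_right _ _)).mp this
  · have hzero : R *ᵥ v = 0 := by
      funext i
      refine Polynomial.eq_zero_of_dvd_of_natDegree_lt (hall i) ?_
      rw [Polynomial.natDegree_pow, Polynomial.natDegree_X_sub_C, mul_one, Nat.lt_succ_iff]
      refine Polynomial.natDegree_sum_le_of_forall_le _ _ fun j _ => ?_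
      refine Polynomial.natDegree_mul_le.trans ?_
      have h1 : ((fun j => R i j) j).natDegree ≤ 1 := hR i j
      have h2 := hv j
      omega
    apply hv0
    rw [Matrix.eq_zero_of_mulVec_eq_zero hdet hzero]
    funext i
    simp

section BlockTri

variable {m1 m2 m3 n1 n3 : ℕ}
    (Ll : Matrix (Fin m1) (Fin n1) (Polynomial ℂ))
    (Am : Matrix (Fin m1) (Fin m2) (Polynomial ℂ))
    (Bm : Matrix (Fin m1) (Fin n3) (Polynomial ℂ))
    (Rm : Matrix (Fin m2) (Fin m2) (Polynomial ℂ))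
    (Cm : Matrix (Fin m2) (Fin n3) (Polynomial ℂ))
    (Lr : Matrix (Fin m3) (Fin n3) (Polynomial ℂ))

theorem blockTri_mulVec_inl (x : Fin n1 ⊕ Fin m2 ⊕ Fin n3 → Polynomial ℂ) (i : Fin m1) :
    (blockTri Ll Am Bm Rm Cm Lr *ᵥ x) (Sum.inl i) = (Ll *ᵥ fun j => x (Sum.inl j)) i
      + ((Am *ᵥ fun j => x (Sum.inr (Sum.inl j))) i
        + (Bm *ᵥ fun j => x (Sum.inr (Sum.inr j))) i) := by
  simp [Matrix.mulVec, dotProduct, blockTri, Fintype.sum_sum_type]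

theorem blockTri_mulVec_inr_inl (x : Fin n1 ⊕ Fin m2 ⊕ Fin n3 → Polynomial ℂ) (i : Fin m2) :
    (blockTri Ll Am Bm Rm Cm Lr *ᵥ x) (Sum.inr (Sum.inl i))
      = (Rm *ᵥ fun j => x (Sum.inr (Sum.inl j))) i
        + (Cm *ᵥ fun j => x (Sum.inr (Sum.inr j))) i := by
  simp [Matrix.mulVec, dotProduct, blockTri, Fintype.sum_sum_type]

theorem blockTri_mulVec_inr_inr (x : Fin n1 ⊕ Fin m2 ⊕ Fin n3 → Polynomial ℂ) (i : Fin m3) :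
    (blockTri Ll Am Bm Rm Cm Lr *ᵥ x) (Sum.inr (Sum.inr i))
      = (Lr *ᵥ fun j => x (Sum.inr (Sum.inr j))) i := by
  simp [Matrix.mulVec, dotProduct, blockTri, Fintype.sum_sum_type]

variable {Ll Am Bm Rm Cm Lr}

/-- The right kernel of the block triangular matrix lives in the first block of columns. -/
theorem apply_inr_eq_zero_of_blockTri_mulVec_eq_zero {μ : ℂ} (hdet : Rm.det ≠ 0)
    (hLr : (evalMat Lr μ).rank = n3) {x : Fin n1 ⊕ Fin m2 ⊕ Fin n3 → Polynomial ℂ}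
    (hx : blockTri Ll Am Bm Rm Cm Lr *ᵥ x = 0) (c : Fin m2 ⊕ Fin n3) : x (Sum.inr c) = 0 := by
  have h3 : (fun j => x (Sum.inr (Sum.inr j))) = 0 := by
    refine eq_zero_of_mulVec_eq_zero_of_rank_evalMat (μ := μ) (by simpa using hLr) ?_
    funext i
    rw [← blockTri_mulVec_inr_inr Ll Am Bm Rm Cm Lr, hx]
    rfl
  have h2 : (fun j => x (Sum.inr (Sum.inl j))) = 0 := by
    refine Matrix.eq_zero_of_mulVec_eq_zero hdet ?_
    funext i
    have := blockTri_mulVec_inr_inl Ll Am Bm Rm Cm Lr x i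
    rw [hx, h3, Matrix.mulVec_zero] at this
    simpa using this.symm
  rcases c with c | c
  · exact congrFun h2 c
  · exact congrFun h3 c

/-- A zero direction `v` of the regular block lifts to the root polynomial `[u; v; 0]` of the
block triangular matrix whenever `u` solves `Ll u + Am v = 0`. -/
theorem isRootPoly_blockTri {μ : ℂ} {k : ℕ} (hdet : Rm.det ≠ 0)
    (hLr : (evalMat Lr μ).rank = n3) {u : Fin n1 → Polynomial ℂ} {v : Fin m2 → Polynomial ℂ}
    (hu : Ll *ᵥ u + Am *ᵥ v = 0) (hv : IsZeroDirection Rm μ k v) :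
    IsRootPoly (blockTri Ll Am Bm Rm Cm Lr) μ k (Sum.elim u (Sum.elim v fun _ => 0)) := by
  obtain ⟨hk, hne, hdvd, hndvd⟩ := hv
  have hz : (fun _ : Fin n3 => (0 : Polynomial ℂ)) = 0 := rfl
  have hq1 : ∀ i, (blockTri Ll Am Bm Rm Cm Lr *ᵥ Sum.elim u (Sum.elim v fun _ => 0)) (Sum.inl i)
      = 0 := by
    intro i
    rw [blockTri_mulVec_inl]
    simpa [hz] using congrFun hu i
  have hq2 : ∀ i, (blockTri Ll Am Bm Rm Cm Lr *ᵥ Sum.elim u (Sum.elim v fun _ => 0))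
      (Sum.inr (Sum.inl i)) = (Rm *ᵥ v) i := by
    intro i
    rw [blockTri_mulVec_inr_inl]
    simp [hz]
  have hq3 : ∀ i, (blockTri Ll Am Bm Rm Cm Lr *ᵥ Sum.elim u (Sum.elim v fun _ => 0))
      (Sum.inr (Sum.inr i)) = 0 := by
    intro i
    rw [blockTri_mulVec_inr_inr]
    simp [hz]
  refine ⟨⟨hk, fun h0 => hne ?_, ?_, fun hall => hndvd fun i => ?_⟩, fun p N hN => ?_⟩
  · funext i
    exact congrFun h0 (Sum.inr (Sum.inl i))
  · rintro (i | i | i)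
    · rw [hq1]
      exact dvd_zero _
    · rw [hq2]
      exact hdvd i
    · rw [hq3]
      exact dvd_zero _
  · rw [← hq2]
    exact hall _
  · suffices h : _ = Fintype.card (Fin p ⊕ Fin 1) by simpa using h
    rw [Matrix.rank_eq_card_iff]
    intro y hy
    have hrow : ∀ i, ∑ a, (N i a).eval μ * y (Sum.inl a)
        + (Sum.elim u (Sum.elim v fun _ => 0) i).eval μ * y (Sum.inr 0) = 0 := by
      intro i
      simpa [Matrix.mulVec, dotProduct, Fintype.sum_sum_type] using congrFun hy i
    have hlast : y (Sum.inr 0) = 0 := by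
      obtain ⟨i, hi⟩ : ∃ i, (v i).eval μ ≠ 0 := by
        by_contra! h
        exact hne (funext h)
      have hN0 : ∀ a, N (Sum.inr (Sum.inl i)) a = 0 := fun a =>
        apply_inr_eq_zero_of_blockTri_mulVec_eq_zero hdet hLr
          (mulVec_col_eq_zero_of_isMinimalBasis hN a) (Sum.inl i)
      simpa [hN0, hi] using hrow (Sum.inr (Sum.inl i))
    have hfirst : (fun a => y (Sum.inl a)) = 0 := by
      refine eq_zero_of_evalMat_mulVec_eq_zero hN μ _ ?_
      funext i
      simpa [hlast, Matrix.mulVec, dotProduct, evalMat] using hrow i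
    funext a
    rcases a with a | a
    · exact congrFun hfirst a
    · rw [Subsingleton.elim a 0, hlast]
      rfl

end BlockTri

/-- Proposition: lifting root polynomials through the block triangular form.
With `L = [[Lℓ, A, B], [0, R, C], [0, 0, Lr]]` as above, if `v(λ) + (λ−λ₀)^ℓ z(λ)` is a root
polynomial of order `ℓ` at `λ₀` for `R`, with `deg v ≤ ℓ − 1`, then there is a polynomial
vector `u` such that `q = [u; v; 0]` is a root polynomial of order exactly `ℓ` at `λ₀` for
`L`; one may take `u = −Lℓ^R A v` for any polynomial right inverse `Lℓ^R` of `Lℓ`, and in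
particular `u = 0` when `A = 0`. -/
theorem root_polynomial_lift_block_triangular
    {m1 m2 m3 n1 n3 : ℕ} (lam0 : ℂ)
    (Ll : Matrix (Fin m1) (Fin n1) (Polynomial ℂ))
    (Am : Matrix (Fin m1) (Fin m2) (Polynomial ℂ))
    (Bm : Matrix (Fin m1) (Fin n3) (Polynomial ℂ))
    (Rm : Matrix (Fin m2) (Fin m2) (Polynomial ℂ))
    (Cm : Matrix (Fin m2) (Fin n3) (Polynomial ℂ))
    (Lr : Matrix (Fin m3) (Fin n3) (Polynomial ℂ))
    (hLl : IsPencilMat Ll) (hAm : IsPencilMat Am) (hBm : IsPencilMat Bm)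
    (hRm : IsPencilMat Rm) (hCm : IsPencilMat Cm) (hLr : IsPencilMat Lr)
    (hLlinv : ∃ Rinv : Matrix (Fin n1) (Fin m1) (Polynomial ℂ), Ll * Rinv = 1)
    (hRreg : ∃ (c : ℂ) (d : ℕ), c ≠ 0 ∧
      Rm.det = Polynomial.C c * (Polynomial.X - Polynomial.C lam0) ^ d)
    (hLr0 : (evalMat Lr lam0).rank = n3)
    (ℓ : ℕ) (v z : Fin m2 → Polynomial ℂ)
    (hv : ∀ i, (v i).natDegree ≤ ℓ - 1)
    (hroot : IsRootPoly Rm lam0 ℓ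
      (fun i => v i + (Polynomial.X - Polynomial.C lam0) ^ ℓ * z i)) :
    (∃ u : Fin n1 → Polynomial ℂ,
      IsRootPoly (blockTri Ll Am Bm Rm Cm Lr) lam0 ℓ
        (Sum.elim u (Sum.elim v fun _ => 0))) ∧
    (∀ Rinv : Matrix (Fin n1) (Fin m1) (Polynomial ℂ), Ll * Rinv = 1 →
      IsRootPoly (blockTri Ll Am Bm Rm Cm Lr) lam0 ℓ
        (Sum.elim (fun i => -((Rinv * Am).mulVec v i)) (Sum.elim v fun _ => 0))) ∧
    (Am = 0 →
      IsRootPoly (blockTri Ll Am Bm Rm Cm Lr) lam0 ℓ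
        (Sum.elim (fun _ => 0) (Sum.elim v fun _ => 0))) := by
  obtain ⟨c, d, hc, hdet⟩ := hRreg
  have hdet0 : Rm.det ≠ 0 := by
    rw [hdet]
    exact mul_ne_zero (Polynomial.C_ne_zero.mpr hc)
      (pow_ne_zero _ (Polynomial.X_sub_C_ne_zero lam0))
  have hzero := isZeroDirection_of_add_pow_mul hRm hdet0 hv hroot.1
  have hlift : ∀ Rinv : Matrix (Fin n1) (Fin m1) (Polynomial ℂ), Ll * Rinv = 1 →
      IsRootPoly (blockTri Ll Am Bm Rm Cm Lr) lam0 ℓ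
        (Sum.elim (fun i => -((Rinv * Am).mulVec v i)) (Sum.elim v fun _ => 0)) := by
    intro Rinv hRinv
    have hu : Ll *ᵥ (-((Rinv * Am) *ᵥ v)) + Am *ᵥ v = 0 := by
      rw [Matrix.mulVec_neg, Matrix.mulVec_mulVec, ← Matrix.mul_assoc, hRinv, Matrix.one_mul,
        neg_add_cancel]
    exact isRootPoly_blockTri hdet0 hLr0 hu hzero
  obtain ⟨Rinv, hRinv⟩ := hLlinv
  refine ⟨⟨_, hlift Rinv hRinv⟩, hlift, fun hA => ?_⟩
  have hu : Ll *ᵥ (0 : Fin n1 → Polynomial ℂ) + Am *ᵥ v = 0 := by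
    rw [hA, Matrix.mulVec_zero, Matrix.zero_mulVec, add_zero]
  exact isRootPoly_blockTri hdet0 hLr0 hu hzero

end
end

section
/- Let L(λ) be a pencil in the assumed block upper triangular form with diagonal blocks L_ℓ(λ), R(λ), L_r(λ). Suppose g(λ)=[a(λ); b(λ); c(λ)]+(λ−λ_0)^ℓ r(λ) is a root polynomial of order ℓ at λ_0 for L(λ), where the blocks a(λ), b(λ), c(λ) are conformal with the block columns of L(λ), the polynomial vector [a(λ); b(λ); c(λ)] has degree at most ℓ−1, and r(λ) is a polynomial vector. Then c(λ)=0 and b(λ) is a root polynomial of order exactly ℓ at λ_0 for R(λ). -/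
open Polynomial Matrix

noncomputable section

section BlockProducts

variable {m1 m2 m3 n1 n3 : ℕ}
  (Ll : Matrix (Fin m1) (Fin n1) (Polynomial ℂ)) (Am : Matrix (Fin m1) (Fin m2) (Polynomial ℂ))
  (Bm : Matrix (Fin m1) (Fin n3) (Polynomial ℂ)) (Rm : Matrix (Fin m2) (Fin m2) (Polynomial ℂ))
  (Cm : Matrix (Fin m2) (Fin n3) (Polynomial ℂ)) (Lr : Matrix (Fin m3) (Fin n3) (Polynomial ℂ))
  (y : Fin n1 ⊕ Fin m2 ⊕ Fin n3 → Polynomial ℂ)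

lemma blockTri_mulVec_top (i : Fin m1) :
    (blockTri Ll Am Bm Rm Cm Lr).mulVec y (Sum.inl i) =
      Ll.mulVec (fun j => y (Sum.inl j)) i + (Am.mulVec (fun j => y (Sum.inr (Sum.inl j))) i +
        Bm.mulVec (fun j => y (Sum.inr (Sum.inr j))) i) := by
  simp [mulVec, dotProduct, Fintype.sum_sum_type, blockTri]

lemma blockTri_mulVec_mid (i : Fin m2) :
    (blockTri Ll Am Bm Rm Cm Lr).mulVec y (Sum.inr (Sum.inl i)) =
      Rm.mulVec (fun j => y (Sum.inr (Sum.inl j))) i +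
        Cm.mulVec (fun j => y (Sum.inr (Sum.inr j))) i := by
  simp [mulVec, dotProduct, Fintype.sum_sum_type, blockTri]

lemma blockTri_mulVec_bot (i : Fin m3) :
    (blockTri Ll Am Bm Rm Cm Lr).mulVec y (Sum.inr (Sum.inr i)) =
      Lr.mulVec (fun j => y (Sum.inr (Sum.inr j))) i := by
  simp [mulVec, dotProduct, Fintype.sum_sum_type, blockTri]

end BlockProducts

lemma eval_mulVec {ι κ : Type*} [Fintype κ] (P : Matrix ι κ (Polynomial ℂ))
    (y : κ → Polynomial ℂ) (μ : ℂ) (i : ι) :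
    (P.mulVec y i).eval μ = (evalMat P μ).mulVec (fun j => (y j).eval μ) i := by
  simp [mulVec, dotProduct, evalMat, eval_finsetSum]

lemma toRat_mulVec {ι κ : Type*} [Fintype κ] (P : Matrix ι κ (Polynomial ℂ))
    (y : κ → Polynomial ℂ) (i : ι) :
    (toRat P).mulVec (fun j => algebraMap (Polynomial ℂ) (RatFunc ℂ) (y j)) i =
      algebraMap (Polynomial ℂ) (RatFunc ℂ) (P.mulVec y i) := by
  simp [mulVec, dotProduct, toRat]

/-- Every column of a polynomial basis of the right nullspace is annihilated by the matrix. -/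
lemma IsMinimalBasis.mulVec_eq_zero {ι κ : Type*} [Fintype ι] [Fintype κ]
    {P : Matrix ι κ (Polynomial ℂ)} {p : ℕ} {N : Matrix κ (Fin p) (Polynomial ℂ)}
    (h : IsMinimalBasis P N) (j : Fin p) : P.mulVec (fun i => N i j) = 0 := by
  have hj : (fun i => toRat N i j) ∈ rightNullspace P :=
    h.2.1 ▸ Submodule.subset_span ⟨j, rfl⟩
  funext i
  have := congrFun (LinearMap.mem_ker.1 hj) i
  have h2 := toRat_mulVec P (fun i => N i j) i
  refine (map_eq_zero_iff (algebraMap (Polynomial ℂ) (RatFunc ℂ))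
    (IsFractionRing.injective (Polynomial ℂ) (RatFunc ℂ))).1 ?_
  rw [← h2]
  exact this

lemma IsMinimalBasis.column_ne_zero {ι κ : Type*} [Fintype ι] [Fintype κ]
    {P : Matrix ι κ (Polynomial ℂ)} {p : ℕ} {N : Matrix κ (Fin p) (Polynomial ℂ)}
    (h : IsMinimalBasis P N) (j : Fin p) : (fun i => N i j) ≠ 0 := by
  intro h0
  refine h.1.ne_zero j ?_
  funext i
  simpa [toRat] using congrFun h0 i

/-- A right minimal basis exists. -/
lemma exists_isMinimalBasis {ι κ : Type*} [Fintype ι] [Fintype κ]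
    (P : Matrix ι κ (Polynomial ℂ)) :
    ∃ N : Matrix κ (Fin (Module.finrank (RatFunc ℂ) (rightNullspace P))) (Polynomial ℂ),
      IsMinimalBasis P N := by
  set p := Module.finrank (RatFunc ℂ) (rightNullspace P) with hp
  let S : Set (Matrix κ (Fin p) (Polynomial ℂ)) := {M |
    LinearIndependent (RatFunc ℂ) (fun j : Fin p => fun i : κ => toRat M i j) ∧
    Submodule.span (RatFunc ℂ) (Set.range fun j : Fin p => fun i : κ => toRat M i j)
      = rightNullspace P}
  have hS : S.Nonempty := by
    let v := Module.finBasis (RatFunc ℂ) (rightNullspace P)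
    have hd : ∀ j : Fin p, ∃ d : nonZeroDivisors (Polynomial ℂ), ∀ i : κ,
        IsLocalization.IsInteger (Polynomial ℂ) ((d : Polynomial ℂ) • (v j : κ → RatFunc ℂ) i) :=
      fun j => IsLocalization.exist_integer_multiples_of_finite (nonZeroDivisors (Polynomial ℂ)) _
    choose d hd using hd
    choose M hM using hd
    have hne : ∀ j, algebraMap (Polynomial ℂ) (RatFunc ℂ) (d j) ≠ 0 := fun j =>
      IsFractionRing.to_map_ne_zero_of_mem_nonZeroDivisors (d j).2
    let u : Fin p → (RatFunc ℂ)ˣ := fun j => Units.mk0 _ (hne j)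
    have hcol : (fun j : Fin p => fun i : κ => toRat (Matrix.of fun i j => M j i) i j) =
        u • fun j => (v j : κ → RatFunc ℂ) := by
      funext j i
      simp only [toRat, map_apply, of_apply, hM, Pi.smul_apply', Pi.smul_apply, Algebra.smul_def]
      rfl
    have hv : LinearIndependent (RatFunc ℂ) fun j => (v j : κ → RatFunc ℂ) :=
      v.linearIndependent.map' (rightNullspace P).subtype (Submodule.ker_subtype _)
    have hli := hv.units_smul u
    rw [← hcol] at hli
    refine ⟨Matrix.of fun i j => M j i, hli, ?_⟩
    refine Submodule.eq_of_le_of_finrank_eq ?_ ?_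
    · rw [Submodule.span_le, hcol]
      rintro _ ⟨j, rfl⟩
      exact (rightNullspace P).smul_mem (u j : RatFunc ℂ) (v j).2
    · rw [finrank_span_eq_card hli, Fintype.card_fin]
  obtain ⟨N, hN, hmin⟩ := exists_minimalFor_of_wellFoundedLT (· ∈ S)
    (fun M => ∑ j, colDegree fun i => M i j) hS
  refine ⟨N, hN.1, hN.2, fun M h1 h2 => ?_⟩
  rcases le_total (∑ j, colDegree fun i => N i j) (∑ j, colDegree fun i => M i j) with h | h
  · exact h
  · exact hmin ⟨h1, h2⟩ h

/-- If `P(λ₀)` has full column rank, then `P` reflects divisibility by powers of `λ - λ₀`. -/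
lemma pow_dvd_of_pow_dvd_mulVec {m n : ℕ} {P : Matrix (Fin m) (Fin n) (Polynomial ℂ)} {μ : ℂ}
    (hP : (evalMat P μ).rank = n) {k : ℕ} {y : Fin n → Polynomial ℂ}
    (h : ∀ i, (X - C μ) ^ k ∣ P.mulVec y i) (j : Fin n) : (X - C μ) ^ k ∣ y j := by
  have hker : LinearMap.ker (evalMat P μ).mulVecLin = ⊥ := by
    have := LinearMap.finrank_range_add_finrank_ker (evalMat P μ).mulVecLin
    rw [Module.finrank_fin_fun] at this
    have h2 : Module.finrank ℂ (LinearMap.range (evalMat P μ).mulVecLin) = n := hP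
    exact Submodule.finrank_eq_zero.1 (by omega)
  obtain ⟨g, hg⟩ := LinearMap.exists_leftInverse_of_injective _ hker
  set G := LinearMap.toMatrix' g
  have hG : G * evalMat P μ = 1 := by
    have h3 := congrArg LinearMap.toMatrix' hg
    rw [LinearMap.toMatrix'_comp] at h3
    rwa [← Matrix.toLin'_apply', LinearMap.toMatrix'_toLin', LinearMap.toMatrix'_id] at h3
  set Q : Matrix (Fin n) (Fin n) (Polynomial ℂ) := G.map C * P with hQ
  have hQe : Q.map (evalRingHom μ) = 1 := by
    rw [hQ, Matrix.map_mul, ← hG]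
    congr 1
    ext i j
    simp
  have hdet : Q.det.eval μ = 1 := by
    have := RingHom.map_det (evalRingHom μ) Q
    rw [RingHom.mapMatrix_apply, hQe, det_one] at this
    exact this
  have hcop : IsCoprime ((X - C μ) ^ k) Q.det := by
    refine IsCoprime.pow_left ?_
    refine ((irreducible_X_sub_C μ).coprime_iff_not_dvd).2 ?_
    rw [dvd_iff_isRoot, IsRoot, hdet]
    exact one_ne_zero
  have hmul : (Q.adjugate * G.map C).mulVec (P.mulVec y) = Q.det • y := by
    rw [mulVec_mulVec, Matrix.mul_assoc, ← hQ, adjugate_mul, smul_mulVec, one_mulVec]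
  refine hcop.dvd_of_dvd_mul_left ?_
  have := congrFun hmul j
  rw [Pi.smul_apply, smul_eq_mul] at this
  rw [← this]
  rw [mulVec, dotProduct]
  exact Finset.dvd_sum fun i _ => (h i).mul_left _

lemma le_finrank_rightNullspace_blockTri {m1 m2 m3 n1 n3 : ℕ}
    (Ll : Matrix (Fin m1) (Fin n1) (Polynomial ℂ)) (Am : Matrix (Fin m1) (Fin m2) (Polynomial ℂ))
    (Bm : Matrix (Fin m1) (Fin n3) (Polynomial ℂ)) (Rm : Matrix (Fin m2) (Fin m2) (Polynomial ℂ))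
    (Cm : Matrix (Fin m2) (Fin n3) (Polynomial ℂ)) (Lr : Matrix (Fin m3) (Fin n3) (Polynomial ℂ)) :
    n1 ≤ m1 + Module.finrank (RatFunc ℂ) (rightNullspace (blockTri Ll Am Bm Rm Cm Lr)) := by
  let J : (Fin n1 → RatFunc ℂ) →ₗ[RatFunc ℂ] (Fin n1 ⊕ Fin m2 ⊕ Fin n3 → RatFunc ℂ) :=
    { toFun := fun x => Sum.elim x 0
      map_add' := fun x y => by ext (_ | _) <;> simp
      map_smul' := fun t x => by ext (_ | _) <;> simp }
  have hJ : Function.Injective J := fun x y h => by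
    funext i
    exact congrFun h (Sum.inl i)
  have hle : (rightNullspace Ll).map J ≤ rightNullspace (blockTri Ll Am Bm Rm Cm Lr) := by
    rintro _ ⟨x, hx, rfl⟩
    have hx : (toRat Ll).mulVec x = 0 := hx
    refine LinearMap.mem_ker.2 (funext ?_)
    rintro (i | i | i)
    · simpa [mulVec, dotProduct, toRat, Fintype.sum_sum_type, blockTri, J] using congrFun hx i
    · simp [mulVec, dotProduct, toRat, Fintype.sum_sum_type, blockTri, J]
    · simp [mulVec, dotProduct, toRat, Fintype.sum_sum_type, blockTri, J]
  have h1 := Submodule.finrank_mono hle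
  have h2 : Module.finrank (RatFunc ℂ) ((rightNullspace Ll).map J) =
      Module.finrank (RatFunc ℂ) (rightNullspace Ll) :=
    (Submodule.equivMapOfInjective J hJ _).finrank_eq.symm
  have h3 := LinearMap.finrank_range_add_finrank_ker (toRat Ll).mulVecLin
  have h4 := Submodule.finrank_le (LinearMap.range (toRat Ll).mulVecLin)
  rw [Module.finrank_fin_fun] at h3 h4
  unfold rightNullspace at *
  omega

/-- If `P` is right invertible, the kernel of its evaluation at any point has dimension `n - m`. -/
lemma finrank_ker_evalMat {m n : ℕ} {P : Matrix (Fin m) (Fin n) (Polynomial ℂ)}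
    (hP : ∃ Q : Matrix (Fin n) (Fin m) (Polynomial ℂ), P * Q = 1) (μ : ℂ) :
    m + Module.finrank ℂ (LinearMap.ker (evalMat P μ).mulVecLin) = n := by
  obtain ⟨Q, hQ⟩ := hP
  have hE : evalMat P μ * evalMat Q μ = 1 := by
    have h1 := Matrix.map_mul (L := P) (M := Q) (f := evalRingHom μ)
    rw [hQ, Matrix.map_one _ (map_zero _) (map_one _)] at h1
    exact h1.symm
  have hsurj : LinearMap.range (evalMat P μ).mulVecLin = ⊤ :=
    LinearMap.range_eq_top.2 fun z => ⟨(evalMat Q μ).mulVec z, by simp [mulVec_mulVec, hE]⟩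
  have h := LinearMap.finrank_range_add_finrank_ker (evalMat P μ).mulVecLin
  rwa [hsurj, finrank_top, Module.finrank_fin_fun, Module.finrank_fin_fun] at h

/-- A matrix supported on its top block of rows, with that block annihilated by `K`, has rank
at most the dimension of the kernel of `K`. -/
lemma rank_le_finrank_ker {m n : ℕ} {α β : Type*} [Fintype α] [Fintype β]
    (K : Matrix (Fin m) (Fin n) ℂ) (A : Matrix (Fin n ⊕ α) β ℂ)
    (h0 : ∀ i j, A (Sum.inr i) j = 0)
    (hK : ∀ j, K.mulVec (fun i => A (Sum.inl i) j) = 0) :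
    A.rank ≤ Module.finrank ℂ (LinearMap.ker K.mulVecLin) := by
  let J : (Fin n → ℂ) →ₗ[ℂ] (Fin n ⊕ α → ℂ) :=
    { toFun := fun x => Sum.elim x 0
      map_add' := fun x y => by ext (_ | _) <;> simp
      map_smul' := fun t x => by ext (_ | _) <;> simp }
  rw [rank_eq_finrank_span_cols]
  refine (Submodule.finrank_mono (t := (LinearMap.ker K.mulVecLin).map J) ?_).trans
    (Submodule.finrank_map_le _ _)
  rw [Submodule.span_le]
  rintro _ ⟨j, rfl⟩
  refine ⟨fun i => A (Sum.inl i) j, hK j, ?_⟩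
  funext q
  rcases q with i | i
  · rfl
  · exact (h0 i j).symm

lemma rank_eq_one_of_col_ne_zero {α : Type*} (A : Matrix α (Fin 0 ⊕ Fin 1) ℂ)
    (h : (fun i => A i (Sum.inr 0)) ≠ 0) : A.rank = 1 := by
  have hli : LinearIndependent ℂ A.col := by
    let _ : Unique (Fin 0 ⊕ Fin 1) := (Equiv.emptySum (Fin 0) (Fin 1)).unique
    exact (linearIndependent_unique_iff (ι := Fin 0 ⊕ Fin 1)).2 h
  rw [rank_eq_finrank_span_cols, finrank_span_eq_card hli]
  simp

lemma mulVec_eq_zero_of_blockTri {m1 m2 m3 n1 n3 : ℕ} {lam0 : ℂ}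
    {Ll : Matrix (Fin m1) (Fin n1) (Polynomial ℂ)} {Am : Matrix (Fin m1) (Fin m2) (Polynomial ℂ)}
    {Bm : Matrix (Fin m1) (Fin n3) (Polynomial ℂ)} {Rm : Matrix (Fin m2) (Fin m2) (Polynomial ℂ)}
    {Cm : Matrix (Fin m2) (Fin n3) (Polynomial ℂ)} {Lr : Matrix (Fin m3) (Fin n3) (Polynomial ℂ)}
    (hR : Rm.det ≠ 0) (hLr0 : (evalMat Lr lam0).rank = n3)
    {y : Fin n1 ⊕ Fin m2 ⊕ Fin n3 → Polynomial ℂ}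
    (hy : (blockTri Ll Am Bm Rm Cm Lr).mulVec y = 0) :
    (∀ j, y (Sum.inr j) = 0) ∧ Ll.mulVec (fun j => y (Sum.inl j)) = 0 := by
  have h3 : (fun j => y (Sum.inr (Sum.inr j))) = 0 := by
    funext j
    have hdvd := pow_dvd_of_pow_dvd_mulVec hLr0
      (k := (y (Sum.inr (Sum.inr j))).natDegree + 1) (y := fun j => y (Sum.inr (Sum.inr j)))
      (fun i => by
        rw [← blockTri_mulVec_bot Ll Am Bm Rm Cm Lr, hy]
        exact dvd_zero _) j
    refine eq_zero_of_dvd_of_natDegree_lt hdvd ?_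
    simp [natDegree_pow]
  have h2 : (fun j => y (Sum.inr (Sum.inl j))) = 0 := by
    refine eq_zero_of_mulVec_eq_zero hR (funext fun i => ?_)
    have := blockTri_mulVec_mid Ll Am Bm Rm Cm Lr y i
    rw [hy, h3] at this
    simpa using this.symm
  refine ⟨?_, funext fun i => ?_⟩
  · rintro (j | j)
    · exact congrFun h2 j
    · exact congrFun h3 j
  · have := blockTri_mulVec_top Ll Am Bm Rm Cm Lr y i
    rw [hy, h3, h2] at this
    simpa using this.symm

/-- Proposition: restriction of root polynomials of the block triangular
form. With `L = [[Lℓ, A, B], [0, R, C], [0, 0, Lr]]` as above, if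
`g(λ) = [a(λ); b(λ); c(λ)] + (λ−λ₀)^ℓ r(λ)` is a root polynomial of order `ℓ` at `λ₀` for
`L`, with `deg [a; b; c] ≤ ℓ − 1`, then `c = 0` and `b` is a root polynomial of order exactly
`ℓ` at `λ₀` for `R`. -/
theorem root_polynomial_restrict_block_triangular
    {m1 m2 m3 n1 n3 : ℕ} (lam0 : ℂ)
    (Ll : Matrix (Fin m1) (Fin n1) (Polynomial ℂ))
    (Am : Matrix (Fin m1) (Fin m2) (Polynomial ℂ))
    (Bm : Matrix (Fin m1) (Fin n3) (Polynomial ℂ))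
    (Rm : Matrix (Fin m2) (Fin m2) (Polynomial ℂ))
    (Cm : Matrix (Fin m2) (Fin n3) (Polynomial ℂ))
    (Lr : Matrix (Fin m3) (Fin n3) (Polynomial ℂ))
    (hLl : IsPencilMat Ll) (hAm : IsPencilMat Am) (hBm : IsPencilMat Bm)
    (hRm : IsPencilMat Rm) (hCm : IsPencilMat Cm) (hLr : IsPencilMat Lr)
    (hLlinv : ∃ Rinv : Matrix (Fin n1) (Fin m1) (Polynomial ℂ), Ll * Rinv = 1)
    (hRreg : ∃ (c : ℂ) (d : ℕ), c ≠ 0 ∧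
      Rm.det = Polynomial.C c * (Polynomial.X - Polynomial.C lam0) ^ d)
    (hLr0 : (evalMat Lr lam0).rank = n3)
    (ℓ : ℕ) (a : Fin n1 → Polynomial ℂ) (b : Fin m2 → Polynomial ℂ)
    (c : Fin n3 → Polynomial ℂ) (rr : (Fin n1 ⊕ Fin m2 ⊕ Fin n3) → Polynomial ℂ)
    (hdeg : ∀ q, ((Sum.elim a (Sum.elim b c)) q).natDegree ≤ ℓ - 1)
    (hg : IsRootPoly (blockTri Ll Am Bm Rm Cm Lr) lam0 ℓ
      (fun q => Sum.elim a (Sum.elim b c) q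
        + (Polynomial.X - Polynomial.C lam0) ^ ℓ * rr q)) :
    c = 0 ∧ IsRootPoly Rm lam0 ℓ b := by
  obtain ⟨⟨hℓ, -, hdvd, -⟩, hrank⟩ := hg
  have hR : Rm.det ≠ 0 := by
    obtain ⟨t, d, ht, hdet⟩ := hRreg
    rw [hdet]
    exact mul_ne_zero (C_ne_zero.2 ht) (pow_ne_zero _ (X_sub_C_ne_zero _))
  have hshift : ∀ {m n : ℕ} (P : Matrix (Fin m) (Fin n) (Polynomial ℂ))
      (x s : Fin n → Polynomial ℂ) (i : Fin m),
      P.mulVec (fun j => x j + (X - C lam0) ^ ℓ * s j) i =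
        P.mulVec x i + (X - C lam0) ^ ℓ * P.mulVec s i := by
    intro m n P x s i
    have : (fun j => x j + (X - C lam0) ^ ℓ * s j) = x + (X - C lam0) ^ ℓ • s := rfl
    rw [this, mulVec_add, mulVec_smul]
    rfl
  have hc : c = 0 := by
    funext j
    have h1 := pow_dvd_of_pow_dvd_mulVec hLr0 (k := ℓ)
      (y := fun j => c j + (X - C lam0) ^ ℓ * rr (Sum.inr (Sum.inr j)))
      (fun i => by
        have := hdvd (Sum.inr (Sum.inr i))
        rwa [blockTri_mulVec_bot] at this) j
    refine eq_zero_of_dvd_of_natDegree_lt ((dvd_add_left (Dvd.intro _ rfl)).1 h1) ?_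
    have := hdeg (Sum.inr (Sum.inr j))
    simp only [Sum.elim_inr] at this
    simp only [natDegree_pow, natDegree_X_sub_C]
    omega
  subst hc
  have hRb : ∀ i, (X - C lam0) ^ ℓ ∣ Rm.mulVec b i := by
    intro i
    have h1 := hdvd (Sum.inr (Sum.inl i))
    rw [blockTri_mulVec_mid] at h1
    simp only [Sum.elim_inr, Sum.elim_inl] at h1
    rw [hshift, hshift, mulVec_zero] at h1
    simp only [Pi.zero_apply, zero_add] at h1
    exact (dvd_add_left (Dvd.intro _ rfl)).1 ((dvd_add_left (Dvd.intro _ rfl)).1 h1)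
  have hb0 : (fun i => (b i).eval lam0) ≠ 0 := by
    intro hb
    obtain ⟨N, hN⟩ := exists_isMinimalBasis (blockTri Ll Am Bm Rm Cm Lr)
    have hrk := hrank _ N hN
    have hcol := fun j => mulVec_eq_zero_of_blockTri hR hLr0 (hN.mulVec_eq_zero j)
    have h0 : ((0 : ℂ)) ^ ℓ = 0 := zero_pow hℓ.ne'
    have hle := rank_le_finrank_ker (evalMat Ll lam0) (Matrix.of fun i j =>
        Sum.elim (fun t => (N i t).eval lam0) (fun _ : Fin 1 => (Sum.elim a (Sum.elim b 0) i
          + (X - C lam0) ^ ℓ * rr i).eval lam0) j) ?_ ?_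
    · rw [hrk] at hle
      have h1 := le_finrank_rightNullspace_blockTri Ll Am Bm Rm Cm Lr
      have h2 := finrank_ker_evalMat hLlinv lam0
      omega
    · rintro i (j | j)
      · simp [(hcol j).1 i]
      · rcases i with i | i
        · simpa [h0] using congrFun hb i
        · simp [h0]
    · rintro (j | j)
      · funext i
        have := eval_mulVec Ll (fun t => N (Sum.inl t) j) lam0 i
        rw [(hcol j).2] at this
        simpa using this.symm
      · funext i
        have h1 := (dvd_pow_self (X - C lam0) hℓ.ne').trans (hdvd (Sum.inl i))
        rw [dvd_iff_isRoot, IsRoot, blockTri_mulVec_top, eval_add, eval_add, eval_mulVec,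
          eval_mulVec, eval_mulVec] at h1
        have hb' : ∀ t, (b t).eval lam0 = 0 := congrFun hb
        have hz : ∀ {m n : ℕ} (M : Matrix (Fin m) (Fin n) ℂ) (s : Fin m),
            M.mulVec (fun _ => 0) s = 0 := fun M s => congrFun (mulVec_zero M) s
        simpa [h0, hb', hz] using h1
  refine ⟨rfl, ⟨hℓ, hb0, hRb, fun hall => hb0 ?_⟩, fun p N hN => ?_⟩
  · have hz : Rm.mulVec b = 0 := by
      funext i
      refine eq_zero_of_dvd_of_natDegree_lt (hall i) ?_
      have hle : (Rm.mulVec b i).natDegree ≤ 1 + (ℓ - 1) := by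
        rw [mulVec, dotProduct]
        exact natDegree_sum_le_of_forall_le _ _ fun j _ =>
          natDegree_mul_le_of_le (hRm i j) (hdeg (Sum.inr (Sum.inl j)))
      simp only [natDegree_pow, natDegree_X_sub_C]
      omega
    rw [eq_zero_of_mulVec_eq_zero hR hz]
    funext i
    simp
  · have hp : p = 0 := by
      by_contra hp
      exact hN.column_ne_zero ⟨0, Nat.pos_of_ne_zero hp⟩
        (eq_zero_of_mulVec_eq_zero hR (hN.mulVec_eq_zero _))
    subst hp
    exact rank_eq_one_of_col_ne_zero _ hb0

end
end

section
/- Let A_ε+λE_ε∈ℂ[λ]^{m×n} be the block bidiagonal pencil of the assumed form, with Z_i=[0 −A_{i,i+1}^{−1}Ê_{i,i}]∈ℂ^{s_i×t_i}. Then the t_1 columns of the polynomial matrix N(λ)∈ℂ[λ]^{n×t_1} whose block rows (of heights t_1,t_2,…,t_k) are N^{(1)}(λ)=I_{t_1} and N^{(i+1)}(λ)=λ^i Z_i Z_{i−1}⋯Z_1 for i=1,…,k−1 form a minimal polynomial basis of the right nullspace of A_ε+λE_ε. In particular (A_ε+λE_ε)N(λ)=0, N(μ) has full column rank for every μ∈ℂ,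 and the columnwise reversal of N(λ) evaluated at 0 has full column rank (N is column reduced). -/
open Polynomial Matrix

noncomputable section

/-- Pad an `s_i × s_i` matrix (`s_i = t (i+1)`) with `t i − t (i+1)` zero columns on the
left, producing an `s_i × t_i` matrix `[0 M]`. -/
def padColsLeft (t : ℕ → ℕ) (i : ℕ) (M : Matrix (Fin (t (i+1))) (Fin (t (i+1))) ℂ) :
    Matrix (Fin (t (i+1))) (Fin (t i)) ℂ :=
  Matrix.of fun a b =>
    if h : (b : ℕ) < t i - t (i+1) then 0
    else M a ⟨(b : ℕ) - (t i - t (i+1)), by have hb := b.isLt; omega⟩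

/-- `Z_i = [0 −A_{i,i+1}⁻¹ Ê_{i,i}]`, the unique solution of `A_{i,i+1} Z_i + E_{i,i} = 0`. -/
def Zblk (t : ℕ → ℕ) (A Ehat : ∀ i : ℕ, Matrix (Fin (t (i+1))) (Fin (t (i+1))) ℂ) (i : ℕ) :
    Matrix (Fin (t (i+1))) (Fin (t i)) ℂ :=
  padColsLeft t i (-((A i)⁻¹ * Ehat i))

/-- The constant term `A_ε` of the block bidiagonal pencil: block `(i, i+1)` equals
`A_{i,i+1}`, all other blocks vanish. -/
def bidiagA (k : ℕ) (t : ℕ → ℕ)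
    (A : ∀ i : ℕ, Matrix (Fin (t (i+1))) (Fin (t (i+1))) ℂ) :
    Matrix (Σ i : Fin (k-1), Fin (t ((i : ℕ)+1))) (Σ j : Fin k, Fin (t (j : ℕ))) ℂ :=
  Matrix.of fun p q =>
    if h : (q.1 : ℕ) = (p.1 : ℕ) + 1 then A (p.1 : ℕ) p.2 (Fin.cast (congrArg t h) q.2)
    else 0

/-- The coefficient `E_ε` of `λ` in the block bidiagonal pencil: block `(i, i)` equals
`E_{i,i} = [0 Ê_{i,i}]`, all other blocks vanish. -/
def bidiagE (k : ℕ) (t : ℕ → ℕ)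
    (Ehat : ∀ i : ℕ, Matrix (Fin (t (i+1))) (Fin (t (i+1))) ℂ) :
    Matrix (Σ i : Fin (k-1), Fin (t ((i : ℕ)+1))) (Σ j : Fin k, Fin (t (j : ℕ))) ℂ :=
  Matrix.of fun p q =>
    if h : (q.1 : ℕ) = (p.1 : ℕ) then
      padColsLeft t (p.1 : ℕ) (Ehat (p.1 : ℕ)) p.2 (Fin.cast (congrArg t h) q.2)
    else 0

/-- The product `Z_{j-1} ⋯ Z_1 Z_0` (equal to `I` for `j = 0`). -/
def Zprod (t : ℕ → ℕ) (A Ehat : ∀ i : ℕ, Matrix (Fin (t (i+1))) (Fin (t (i+1))) ℂ) :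
    (j : ℕ) → Matrix (Fin (t j)) (Fin (t 0)) ℂ
  | 0 => 1
  | j + 1 => Zblk t A Ehat j * Zprod t A Ehat j

/-- The candidate minimal basis `N(λ)`: block row `j` equals `λ^j Z_{j-1} ⋯ Z_1 Z_0`
(`I_{t_1}` for `j = 0`). -/
def Nmb (k : ℕ) (t : ℕ → ℕ) (A Ehat : ∀ i : ℕ, Matrix (Fin (t (i+1))) (Fin (t (i+1))) ℂ) :
    Matrix (Σ j : Fin k, Fin (t (j : ℕ))) (Fin (t 0)) (Polynomial ℂ) :=
  Matrix.of fun p b =>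
    Polynomial.X ^ (p.1 : ℕ) * Polynomial.C (Zprod t A Ehat (p.1 : ℕ) p.2 b)

theorem colDegree_le_mulVec {κ : Type*} [Fintype κ] {p : ℕ} {N : Matrix κ (Fin p) ℂ[X]}
    (hN : Function.Injective (Matrix.of fun (i : κ) (j : Fin p) =>
      (N i j).coeff (colDegree fun l => N l j)).mulVec)
    (q : Fin p → ℂ[X]) {j : Fin p} (hj : q j ≠ 0) :
    (colDegree fun l => N l j) ≤ colDegree (N *ᵥ q) := by
  set d : Fin p → ℕ := fun j => colDegree fun l => N l j
  have hdeg : ∀ i j, (N i j).natDegree ≤ d j := fun i j =>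
    Finset.le_sup (f := fun l => (N l j).natDegree) (Finset.mem_univ i)
  obtain ⟨j₀, hj₀, hmax⟩ := Finset.exists_max_image (Finset.univ.filter fun j => q j ≠ 0)
    (fun j => d j + (q j).natDegree) ⟨j, by simpa using hj⟩
  simp only [Finset.mem_filter, Finset.mem_univ, true_and] at hj₀ hmax
  set D := d j₀ + (q j₀).natDegree with hD
  set c : Fin p → ℂ := fun j => (q j).coeff (D - d j)
  have hc : c ≠ 0 := fun h => hj₀ (leadingCoeff_eq_zero.mp (by
    simpa [c, hD] using congrFun h j₀))
  have hcoeff : ∀ i, ((N *ᵥ q) i).coeff D =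
      (Matrix.of (fun (i : κ) (j : Fin p) => (N i j).coeff (d j)) *ᵥ c) i := by
    intro i
    simp only [Matrix.mulVec, dotProduct, finsetSum_coeff, Matrix.of_apply]
    refine Finset.sum_congr rfl fun j _ => ?_
    by_cases hq : q j = 0
    · simp [c, hq]
    · have h := hmax j hq
      obtain ⟨e, he⟩ : ∃ e, D = d j + e := ⟨D - d j, by omega⟩
      have hce : c j = (q j).coeff e := by simp only [c, he, Nat.add_sub_cancel_left]
      rw [he, hce]
      exact coeff_mul_add_eq_of_natDegree_le (hdeg i j) (by omega)
  obtain ⟨i, hi⟩ : ∃ i, ((N *ᵥ q) i).coeff D ≠ 0 := by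
    by_contra! h
    exact hc (hN (by rw [Matrix.mulVec_zero]; ext i; rw [← hcoeff, h, Pi.zero_apply]))
  calc d j ≤ D := le_trans (Nat.le_add_right _ _) (hmax j hj)
    _ ≤ ((N *ᵥ q) i).natDegree := le_natDegree_of_ne_zero hi
    _ ≤ colDegree (N *ᵥ q) :=
      Finset.le_sup (f := fun l => ((N *ᵥ q) l).natDegree) (Finset.mem_univ i)

theorem sum_colDegree_le_mul {κ : Type*} [Fintype κ] {p : ℕ} {N : Matrix κ (Fin p) ℂ[X]}
    (hN : Function.Injective (Matrix.of fun (i : κ) (j : Fin p) =>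
      (N i j).coeff (colDegree fun l => N l j)).mulVec)
    {Q : Matrix (Fin p) (Fin p) ℂ[X]} (hQ : Q.det ≠ 0) :
    (∑ j, colDegree fun l => N l j) ≤ ∑ j, colDegree fun l => (N * Q) l j := by
  obtain ⟨σ, hσ⟩ : ∃ σ : Equiv.Perm (Fin p), ∏ j, Q (σ j) j ≠ 0 := by
    by_contra! h
    exact hQ (by simp [Matrix.det_apply, h])
  rw [← Equiv.sum_comp σ]
  refine Finset.sum_le_sum fun j _ => ?_
  exact colDegree_le_mulVec hN (fun i => Q i j)
    (Finset.prod_ne_zero_iff.mp hσ j (Finset.mem_univ j))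

theorem det_ne_zero_of_linearIndependent_mul {κ : Type*} [Fintype κ] {p : ℕ}
    {N : Matrix κ (Fin p) ℂ[X]} {Q : Matrix (Fin p) (Fin p) ℂ[X]}
    (h : LinearIndependent (RatFunc ℂ) (fun j : Fin p => fun i : κ => toRat (N * Q) i j)) :
    Q.det ≠ 0 := by
  intro hdet
  obtain ⟨v, hv, hQv⟩ := Matrix.exists_mulVec_eq_zero_iff.mpr hdet
  have hinj : Function.Injective (toRat (N * Q)).mulVec := Matrix.mulVec_injective_iff.mpr h
  refine hv (funext fun j => ?_)
  have hzero : (algebraMap ℂ[X] (RatFunc ℂ)) ∘ v = 0 := hinj <| by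
    rw [Matrix.mulVec_zero]
    ext i
    rw [toRat, ← RingHom.map_mulVec, ← Matrix.mulVec_mulVec, hQv]
    simp
  simpa using congrFun hzero j

theorem rank_eq_of_mulVec_injective {κ K : Type*} [Fintype κ] [Field K] {p : ℕ}
    {M : Matrix κ (Fin p) K} (h : Function.Injective M.mulVec) : M.rank = p := by
  rw [Matrix.rank, LinearMap.finrank_range_of_inj (by exact h)]
  simp

theorem mul_padColsLeft (t : ℕ → ℕ) (i : ℕ) (B M : Matrix (Fin (t (i+1))) (Fin (t (i+1))) ℂ) :
    B * padColsLeft t i M = padColsLeft t i (B * M) := by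
  ext a b
  by_cases h : (b : ℕ) < t i - t (i+1) <;> simp [padColsLeft, Matrix.mul_apply, h]

theorem mul_Zblk (t : ℕ → ℕ) (A Ehat : ∀ i : ℕ, Matrix (Fin (t (i+1))) (Fin (t (i+1))) ℂ)
    {i : ℕ} (hA : IsUnit (A i).det) :
    A i * Zblk t A Ehat i = -padColsLeft t i (Ehat i) := by
  rw [Zblk, mul_padColsLeft, Matrix.mul_neg, Matrix.mul_nonsing_inv_cancel_left _ _ hA]
  ext a b
  by_cases h : (b : ℕ) < t i - t (i+1) <;> simp [padColsLeft, h]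

theorem sum_sigma_dite {R : Type*} [CommRing R] {k : ℕ} {t : ℕ → ℕ} {m : ℕ} (hm : m < k)
    (F : Fin (t m) → R) (x : (Σ j : Fin k, Fin (t (j : ℕ))) → R) :
    (∑ q : (Σ j : Fin k, Fin (t (j : ℕ))),
      (if h : (q.1 : ℕ) = m then F (Fin.cast (congrArg t h) q.2) else 0) * x q) =
    ∑ b, F b * x ⟨⟨m, hm⟩, b⟩ := by
  rw [Fintype.sum_sigma, Finset.sum_eq_single ⟨m, hm⟩]
  · simp
  · intro j _ hj
    have : (j : ℕ) ≠ m := fun h => hj (Fin.ext h)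
    simp [this]
  · simp

theorem pencilMat_bidiag_map_mulVec {R : Type*} [CommRing R] (φ : ℂ[X] →+* R) {k : ℕ} {t : ℕ → ℕ}
    (A Ehat : ∀ i : ℕ, Matrix (Fin (t (i+1))) (Fin (t (i+1))) ℂ)
    (x : (Σ j : Fin k, Fin (t (j : ℕ))) → R) (i : ℕ) (hi : i < k - 1) (a : Fin (t (i+1))) :
    ((pencilMat (bidiagA k t A) (bidiagE k t Ehat)).map φ *ᵥ x) ⟨⟨i, hi⟩, a⟩ =
      ((A i).map (φ.comp C) *ᵥ fun b => x ⟨⟨i + 1, by omega⟩, b⟩) a +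
      φ X * ((padColsLeft t i (Ehat i)).map (φ.comp C) *ᵥ fun b => x ⟨⟨i, by omega⟩, b⟩) a := by
  simp only [Matrix.mulVec, dotProduct, Matrix.map_apply, Finset.mul_sum]
  rw [← sum_sigma_dite (show i + 1 < k by omega) (fun b => (φ.comp C) (A i a b)) x]
  simp only [← mul_assoc]
  rw [← sum_sigma_dite (show i < k by omega)
    (fun b => φ X * (φ.comp C) (padColsLeft t i (Ehat i) a b)) x, ← Finset.sum_add_distrib]
  refine Finset.sum_congr rfl fun q _ => ?_
  simp only [pencilMat, bidiagA, bidiagE, Matrix.of_apply, map_add, map_mul, add_mul]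
  congr 2 <;> split_ifs <;> simp

/-- Vectors annihilated by the pencil are determined by their top block through `N`. -/
theorem pencilMat_bidiag_map_mulVec_eq_zero_iff {R : Type*} [CommRing R] (φ : ℂ[X] →+* R)
    {k : ℕ} (hk : 0 < k) {t : ℕ → ℕ}
    {A : ∀ i : ℕ, Matrix (Fin (t (i+1))) (Fin (t (i+1))) ℂ}
    (Ehat : ∀ i : ℕ, Matrix (Fin (t (i+1))) (Fin (t (i+1))) ℂ)
    (hA : ∀ i, i + 1 < k → IsUnit (A i).det)
    (x : (Σ j : Fin k, Fin (t (j : ℕ))) → R) :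
    (pencilMat (bidiagA k t A) (bidiagE k t Ehat)).map φ *ᵥ x = 0 ↔
      x = (Nmb k t A Ehat).map φ *ᵥ fun b => x ⟨⟨0, hk⟩, b⟩ := by
  have hN : ∀ j (hj : j < k), (fun a => ((Nmb k t A Ehat).map φ *ᵥ fun b => x ⟨⟨0, hk⟩, b⟩)
      ⟨⟨j, hj⟩, a⟩) = φ X ^ j • ((Zprod t A Ehat j).map (φ.comp C) *ᵥ fun b => x ⟨⟨0, hk⟩, b⟩) := by
    intro j hj
    ext a
    simp [Matrix.mulVec, dotProduct, Nmb, Finset.mul_sum, mul_assoc, mul_left_comm]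
  have hstep : ∀ i (hi : i + 1 < k),
      (∀ a : Fin (t (i+1)), ((pencilMat (bidiagA k t A) (bidiagE k t Ehat)).map φ *ᵥ x)
        ⟨⟨i, by omega⟩, a⟩ = 0) ↔
      (fun a => x ⟨⟨i + 1, hi⟩, a⟩) =
        φ X • ((Zblk t A Ehat i).map (φ.comp C) *ᵥ fun b => x ⟨⟨i, by omega⟩, b⟩) := by
    intro i hi
    set ψ := φ.comp C with hψ
    have hE : (padColsLeft t i (Ehat i)).map ψ = -((A i).map ψ * (Zblk t A Ehat i).map ψ) := by
      rw [← Matrix.map_mul, mul_Zblk t A Ehat (hA i hi)]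
      ext; simp
    have hinj : Function.Injective ((A i).map ψ).mulVec := by
      have hinv : ((A i)⁻¹).map ψ * (A i).map ψ = 1 := by
        rw [← Matrix.map_mul, Matrix.nonsing_inv_mul _ (hA i hi)]
        simp
      intro v w hvw
      simpa [Matrix.mulVec_mulVec, hinv] using congrArg (((A i)⁻¹).map ψ).mulVec hvw
    rw [← hinj.eq_iff, ← funext_iff (g := fun _ => (0 : R))]
    simp only [pencilMat_bidiag_map_mulVec φ A Ehat x i (by omega), ← hψ, hE]
    simp only [funext_iff, Matrix.mulVec_smul, Matrix.neg_mulVec, Matrix.mulVec_mulVec,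
      Pi.neg_apply, Pi.smul_apply, smul_eq_mul, mul_neg, ← sub_eq_add_neg, sub_eq_zero]
  have hZ : ∀ j, (Zprod t A Ehat (j+1)).map (φ.comp C) =
      (Zblk t A Ehat j).map (φ.comp C) * (Zprod t A Ehat j).map (φ.comp C) := fun j => by
    rw [Zprod, Matrix.map_mul]
  constructor
  · intro h
    have hrow : ∀ j (hj : j < k), (fun a => x ⟨⟨j, hj⟩, a⟩) =
        φ X ^ j • ((Zprod t A Ehat j).map (φ.comp C) *ᵥ fun b => x ⟨⟨0, hk⟩, b⟩) := by
      intro j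
      induction j with
      | zero => intro hj; simp [Zprod]
      | succ j ih =>
        intro hj
        rw [(hstep j hj).mp fun a => congrFun h _, ih (by omega), hZ, Matrix.mulVec_smul,
          smul_smul, Matrix.mulVec_mulVec, pow_succ']
    ext ⟨⟨j, hj⟩, a⟩
    exact congrFun ((hrow j hj).trans (hN j hj).symm) a
  · intro h
    have hrow : ∀ j (hj : j < k), (fun a => x ⟨⟨j, hj⟩, a⟩) =
        φ X ^ j • ((Zprod t A Ehat j).map (φ.comp C) *ᵥ fun b => x ⟨⟨0, hk⟩, b⟩) := by
      intro j hj
      rw [← hN j hj]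
      exact funext fun a => congrFun h _
    ext ⟨⟨i, hi⟩, a⟩
    refine (hstep i (by omega)).mpr ?_ a
    rw [hrow (i + 1) (by omega), hrow i (by omega), hZ, Matrix.mulVec_smul, smul_smul,
      Matrix.mulVec_mulVec, pow_succ']

theorem Nmb_top_block (k : ℕ) (hk : 0 < k) (t : ℕ → ℕ)
    (A Ehat : ∀ i : ℕ, Matrix (Fin (t (i+1))) (Fin (t (i+1))) ℂ) (b c : Fin (t 0)) :
    Nmb k t A Ehat ⟨⟨0, hk⟩, b⟩ c = (1 : Matrix (Fin (t 0)) (Fin (t 0)) ℂ[X]) b c := by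
  by_cases h : b = c <;> simp [Nmb, Zprod, Matrix.one_apply, h]

theorem Nmb_map_mulVec_top {R : Type*} [CommRing R] (φ : ℂ[X] →+* R) (k : ℕ) (hk : 0 < k)
    (t : ℕ → ℕ) (A Ehat : ∀ i : ℕ, Matrix (Fin (t (i+1))) (Fin (t (i+1))) ℂ)
    (v : Fin (t 0) → R) (b : Fin (t 0)) :
    ((Nmb k t A Ehat).map φ *ᵥ v) ⟨⟨0, hk⟩, b⟩ = v b := by
  simp [Matrix.mulVec, dotProduct, Nmb_top_block, Matrix.one_apply, apply_ite φ]

theorem Nmb_map_mulVec_injective {R : Type*} [CommRing R] (φ : ℂ[X] →+* R) (k : ℕ) (hk : 0 < k)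
    (t : ℕ → ℕ) (A Ehat : ∀ i : ℕ, Matrix (Fin (t (i+1))) (Fin (t (i+1))) ℂ) :
    Function.Injective ((Nmb k t A Ehat).map φ).mulVec := fun v w h =>
  funext fun b => by
    rw [← Nmb_map_mulVec_top φ k hk t A Ehat v b, ← Nmb_map_mulVec_top φ k hk t A Ehat w b, h]

theorem pencilMat_bidiag_map_mulVec_Nmb {R : Type*} [CommRing R] (φ : ℂ[X] →+* R)
    {k : ℕ} (hk : 0 < k) {t : ℕ → ℕ}
    {A : ∀ i : ℕ, Matrix (Fin (t (i+1))) (Fin (t (i+1))) ℂ}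
    (Ehat : ∀ i : ℕ, Matrix (Fin (t (i+1))) (Fin (t (i+1))) ℂ)
    (hA : ∀ i, i + 1 < k → IsUnit (A i).det) (v : Fin (t 0) → R) :
    (pencilMat (bidiagA k t A) (bidiagE k t Ehat)).map φ *ᵥ
      ((Nmb k t A Ehat).map φ *ᵥ v) = 0 :=
  (pencilMat_bidiag_map_mulVec_eq_zero_iff φ hk Ehat hA _).mpr
    (by simp only [Nmb_map_mulVec_top])

theorem range_Nmb_mulVecLin {k : ℕ} (hk : 0 < k) {t : ℕ → ℕ}
    {A : ∀ i : ℕ, Matrix (Fin (t (i+1))) (Fin (t (i+1))) ℂ}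
    (Ehat : ∀ i : ℕ, Matrix (Fin (t (i+1))) (Fin (t (i+1))) ℂ)
    (hA : ∀ i, i + 1 < k → IsUnit (A i).det) :
    LinearMap.range (toRat (Nmb k t A Ehat)).mulVecLin =
      rightNullspace (pencilMat (bidiagA k t A) (bidiagE k t Ehat)) := by
  ext x
  simp only [rightNullspace, LinearMap.mem_range, LinearMap.mem_ker, Matrix.mulVecLin_apply]
  constructor
  · rintro ⟨v, rfl⟩
    exact pencilMat_bidiag_map_mulVec_Nmb _ hk Ehat hA v
  · intro h
    exact ⟨_, ((pencilMat_bidiag_map_mulVec_eq_zero_iff _ hk Ehat hA x).mp h).symm⟩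

/-- A polynomial matrix whose columns are annihilated by the pencil over `ℂ(λ)` is a polynomial
right multiple of `N`. -/
theorem eq_Nmb_mul_top {k : ℕ} (hk : 0 < k) {t : ℕ → ℕ}
    {A : ∀ i : ℕ, Matrix (Fin (t (i+1))) (Fin (t (i+1))) ℂ}
    (Ehat : ∀ i : ℕ, Matrix (Fin (t (i+1))) (Fin (t (i+1))) ℂ)
    (hA : ∀ i, i + 1 < k → IsUnit (A i).det) {p : ℕ}
    (M : Matrix (Σ j : Fin k, Fin (t (j : ℕ))) (Fin p) ℂ[X])
    (hM : ∀ j, (fun i => toRat M i j) ∈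
      rightNullspace (pencilMat (bidiagA k t A) (bidiagE k t Ehat))) :
    M = Nmb k t A Ehat * Matrix.of fun b j => M ⟨⟨0, hk⟩, b⟩ j := by
  ext1 i j
  apply RatFunc.algebraMap_injective ℂ
  have h := (pencilMat_bidiag_map_mulVec_eq_zero_iff _ hk Ehat hA _).mp (hM j)
  refine (congrFun h i).trans ?_
  simp [toRat, Matrix.mulVec, dotProduct, Matrix.mul_apply]

/-- `Z_i` is in echelon form: its entries vanish below the diagonal ending in the bottom right
corner, and are nonzero on that diagonal. -/
theorem Zblk_echelon {t : ℕ → ℕ} {A Ehat : ∀ i : ℕ, Matrix (Fin (t (i+1))) (Fin (t (i+1))) ℂ}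
    {i : ℕ} (hA : (A i).IsUpperTriangular) (hAd : IsUnit (A i).det)
    (hE : (Ehat i).IsUpperTriangular) (hEd : IsUnit (Ehat i).det)
    (a : Fin (t (i+1))) (b : Fin (t i)) :
    ((b : ℕ) < a + (t i - t (i+1)) → Zblk t A Ehat i a b = 0) ∧
    ((b : ℕ) = a + (t i - t (i+1)) → Zblk t A Ehat i a b ≠ 0) := by
  have := Matrix.invertibleOfIsUnitDet _ hAd
  have hU : ((A i)⁻¹ * Ehat i).IsUpperTriangular :=
    (Matrix.blockTriangular_inv_of_blockTriangular hA).mul hE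
  have hUd : ((A i)⁻¹ * Ehat i).det ≠ 0 := by
    rw [Matrix.det_mul]
    exact mul_ne_zero (Matrix.isUnit_nonsing_inv_det _ hAd).ne_zero hEd.ne_zero
  rw [Matrix.det_of_isUpperTriangular hU, Finset.prod_ne_zero_iff] at hUd
  simp only [Zblk, padColsLeft, Matrix.of_apply]
  constructor <;> intro hab
  · split_ifs with h
    · rfl
    · rw [Matrix.neg_apply, neg_eq_zero]
      exact hU (show (⟨b - (t i - t (i+1)), by omega⟩ : Fin (t (i+1))) < a from
        Fin.lt_def.mpr (by dsimp only; omega))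
  · rw [dif_neg (by omega), Matrix.neg_apply, neg_ne_zero]
    convert hUd a (Finset.mem_univ a) using 2
    exact Fin.ext (by simp only; omega)

theorem Zprod_echelon {t : ℕ → ℕ} {A Ehat : ∀ i : ℕ, Matrix (Fin (t (i+1))) (Fin (t (i+1))) ℂ}
    {k : ℕ} (hmono : ∀ i, i + 1 < k → t (i + 1) ≤ t i)
    (hZ : ∀ i, i + 1 < k → ∀ (a : Fin (t (i+1))) (b : Fin (t i)),
      ((b : ℕ) < a + (t i - t (i+1)) → Zblk t A Ehat i a b = 0) ∧
      ((b : ℕ) = a + (t i - t (i+1)) → Zblk t A Ehat i a b ≠ 0))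
    (j : ℕ) (hj : j < k) : t j ≤ t 0 ∧ ∀ (a : Fin (t j)) (b : Fin (t 0)),
      ((b : ℕ) < a + (t 0 - t j) → Zprod t A Ehat j a b = 0) ∧
      ((b : ℕ) = a + (t 0 - t j) → Zprod t A Ehat j a b ≠ 0) := by
  induction j with
  | zero =>
    refine ⟨le_rfl, fun a b => ⟨fun h => ?_, fun h => ?_⟩⟩
    · exact Matrix.one_apply_ne (by rintro rfl; omega)
    · obtain rfl : a = b := Fin.ext (by omega)
      simp [Zprod]
  | succ j ih =>
    obtain ⟨hle, ih⟩ := ih (by omega)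
    have hm := hmono j hj
    refine ⟨hm.trans hle, fun a b => ⟨fun h => ?_, fun h => ?_⟩⟩
    · rw [Zprod, Matrix.mul_apply]
      refine Finset.sum_eq_zero fun c _ => ?_
      by_cases hc : (c : ℕ) < a + (t j - t (j+1))
      · rw [(hZ j hj a c).1 hc, zero_mul]
      · rw [(ih c b).1 (by omega), mul_zero]
    · have ha := a.isLt
      rw [Zprod, Matrix.mul_apply, Finset.sum_eq_single ⟨a + (t j - t (j+1)), by omega⟩]
      · exact mul_ne_zero ((hZ j hj a _).2 rfl) ((ih _ b).2 (by simp only; omega))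
      · intro c _ hne
        have hne : (c : ℕ) ≠ a + (t j - t (j+1)) := fun h => hne (Fin.ext h)
        by_cases hc : (c : ℕ) < a + (t j - t (j+1))
        · rw [(hZ j hj a c).1 hc, zero_mul]
        · rw [(ih c b).1 (by omega), mul_zero]
      · simp

theorem Nmb_coeff (k : ℕ) (t : ℕ → ℕ)
    (A Ehat : ∀ i : ℕ, Matrix (Fin (t (i+1))) (Fin (t (i+1))) ℂ)
    (p : Σ j : Fin k, Fin (t (j : ℕ))) (b : Fin (t 0)) (n : ℕ) :
    (Nmb k t A Ehat p b).coeff n = if n = p.1 then Zprod t A Ehat p.1 p.2 b else 0 := by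
  rw [Nmb, Matrix.of_apply, mul_comm, coeff_C_mul_X_pow]

/-- Column `b` of block row `colDegree` of `N` meets the echelon diagonal of that block. -/
theorem colDegree_Nmb_spec {k : ℕ} (hk : 0 < k) {t : ℕ → ℕ}
    {A Ehat : ∀ i : ℕ, Matrix (Fin (t (i+1))) (Fin (t (i+1))) ℂ}
    (hZ : ∀ j, j < k → t j ≤ t 0 ∧ ∀ (a : Fin (t j)) (b : Fin (t 0)),
      ((b : ℕ) < a + (t 0 - t j) → Zprod t A Ehat j a b = 0) ∧
      ((b : ℕ) = a + (t 0 - t j) → Zprod t A Ehat j a b ≠ 0)) (b : Fin (t 0)) :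
    (colDegree fun q => Nmb k t A Ehat q b) < k ∧
      t 0 - t (colDegree fun q => Nmb k t A Ehat q b) ≤ b := by
  obtain ⟨p, -, hp⟩ := Finset.exists_mem_eq_sup Finset.univ
    ⟨(⟨⟨0, hk⟩, b⟩ : Σ j : Fin k, Fin (t (j : ℕ))), Finset.mem_univ _⟩
    (fun q => (Nmb k t A Ehat q b).natDegree)
  rw [show (colDegree fun q => Nmb k t A Ehat q b) = _ from hp]
  by_cases hz : Zprod t A Ehat p.1 p.2 b = 0
  · simp [Nmb, hz, hk]
  · have hdeg : (Nmb k t A Ehat p b).natDegree = p.1 := by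
      rw [Nmb, Matrix.of_apply, mul_comm, natDegree_C_mul_X_pow _ _ hz]
    rw [hdeg]
    refine ⟨p.1.isLt, ?_⟩
    by_contra! h
    exact hz (((hZ p.1 p.1.isLt).2 p.2 b).1 (by omega))

theorem Nmb_leadingCoeff_mulVec_injective {k : ℕ} (hk : 0 < k) {t : ℕ → ℕ}
    {A Ehat : ∀ i : ℕ, Matrix (Fin (t (i+1))) (Fin (t (i+1))) ℂ}
    (hZ : ∀ j, j < k → t j ≤ t 0 ∧ ∀ (a : Fin (t j)) (b : Fin (t 0)),
      ((b : ℕ) < a + (t 0 - t j) → Zprod t A Ehat j a b = 0) ∧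
      ((b : ℕ) = a + (t 0 - t j) → Zprod t A Ehat j a b ≠ 0)) :
    Function.Injective (Matrix.of fun (p : Σ j : Fin k, Fin (t (j : ℕ))) (b : Fin (t 0)) =>
      (Nmb k t A Ehat p b).coeff (colDegree fun q => Nmb k t A Ehat q b)).mulVec := by
  rw [← Matrix.coe_mulVecLin, injective_iff_map_eq_zero]
  intro c hc
  by_contra hne
  obtain ⟨b₀, hb₀⟩ := Function.ne_iff.mp hne
  obtain ⟨b, hb, hmax⟩ := Finset.exists_max_image (Finset.univ.filter fun b => c b ≠ 0) id
    ⟨b₀, by simpa using hb₀⟩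
  simp only [Finset.mem_filter, Finset.mem_univ, true_and, id] at hb hmax
  obtain ⟨hlt, hoff⟩ := colDegree_Nmb_spec hk hZ b
  set d := colDegree fun q => Nmb k t A Ehat q b with hd
  obtain ⟨hle, hZd⟩ := hZ d hlt
  have hrow := congrFun hc ⟨⟨d, hlt⟩, ⟨b - (t 0 - t d), by
    show (b : ℕ) - (t 0 - t d) < t d
    have := b.isLt
    omega⟩⟩
  rw [Matrix.mulVecLin_apply, Matrix.mulVec, dotProduct, Finset.sum_eq_single b] at hrow
  · rw [Matrix.of_apply, ← hd, Nmb_coeff, if_pos rfl] at hrow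
    exact mul_ne_zero ((hZd _ b).2 (by dsimp only; omega)) hb hrow
  · intro b' _ hb'
    by_cases hc' : c b' = 0
    · rw [hc', mul_zero]
    · have hlt' : (b' : ℕ) < b := lt_of_le_of_ne (hmax b' hc') (Fin.val_ne_of_ne hb')
      rw [Matrix.of_apply, Nmb_coeff, (hZd _ b').1 (by dsimp only; omega), ite_self, zero_mul]
  · simp

/-- Theorem on the minimal basis of a block bidiagonal pencil. Let
`A_ε + λE_ε` be the block bidiagonal pencil with invertible upper triangular stairs
`A_{i,i+1}` and `Ê_{i,i}` (`E_{i,i} = [0 Ê_{i,i}]`), block rows of sizes `s_i = t_{i+1}` and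
block columns of sizes `t_1 ≥ … ≥ t_k ≥ 1`. Then the `t_1` columns of
`N(λ) = [I; λZ_1; …; λ^{k-1} Z_{k-1}⋯Z_1]`, with `Z_i = [0 −A_{i,i+1}⁻¹Ê_{i,i}]`, form a
minimal polynomial basis of the right nullspace of `A_ε + λE_ε`; in particular
`(A_ε + λE_ε)N(λ) = 0`, `N(μ)` has full column rank for every `μ ∈ ℂ`, and the columnwise
reversal of `N` evaluated at `0` (its highest-column-degree coefficient matrix) has full
column rank. -/
theorem minimal_basis_of_bidiagonal_pencil
    (k : ℕ) (hk : 2 ≤ k) (t : ℕ → ℕ)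
    (htpos : ∀ i, i < k → 1 ≤ t i)
    (hmono : ∀ i, i + 1 < k → t (i + 1) ≤ t i)
    (A Ehat : ∀ i : ℕ, Matrix (Fin (t (i+1))) (Fin (t (i+1))) ℂ)
    (hAtri : ∀ i, i + 1 < k → ∀ a b : Fin (t (i+1)), (b : ℕ) < (a : ℕ) → A i a b = 0)
    (hAdiag : ∀ i, i + 1 < k → ∀ a : Fin (t (i+1)), A i a a ≠ 0)
    (hEtri : ∀ i, i + 1 < k → ∀ a b : Fin (t (i+1)), (b : ℕ) < (a : ℕ) → Ehat i a b = 0)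
    (hEdiag : ∀ i, i + 1 < k → ∀ a : Fin (t (i+1)), Ehat i a a ≠ 0) :
    IsMinimalBasis (pencilMat (bidiagA k t A) (bidiagE k t Ehat)) (Nmb k t A Ehat) ∧
    pencilMat (bidiagA k t A) (bidiagE k t Ehat) * Nmb k t A Ehat = 0 ∧
    (∀ μ : ℂ, (evalMat (Nmb k t A Ehat) μ).rank = t 0) ∧
    (Matrix.of fun (p : Σ j : Fin k, Fin (t (j : ℕ))) (b : Fin (t 0)) =>
      (Nmb k t A Ehat p b).coeff (colDegree fun q => Nmb k t A Ehat q b)).rank = t 0 := by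
  have hk0 : 0 < k := by omega
  have hAu : ∀ i, i + 1 < k → (A i).IsUpperTriangular := fun i hi a b h => hAtri i hi a b h
  have hEu : ∀ i, i + 1 < k → (Ehat i).IsUpperTriangular := fun i hi a b h => hEtri i hi a b h
  have hAd : ∀ i, i + 1 < k → IsUnit (A i).det := fun i hi => by
    rw [isUnit_iff_ne_zero, Matrix.det_of_isUpperTriangular (hAu i hi)]
    exact Finset.prod_ne_zero_iff.mpr fun a _ => hAdiag i hi a
  have hEd : ∀ i, i + 1 < k → IsUnit (Ehat i).det := fun i hi => by
    rw [isUnit_iff_ne_zero, Matrix.det_of_isUpperTriangular (hEu i hi)]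
    exact Finset.prod_ne_zero_iff.mpr fun a _ => hEdiag i hi a
  have hlead := Nmb_leadingCoeff_mulVec_injective hk0 (Zprod_echelon hmono fun i hi =>
    Zblk_echelon (hAu i hi) (hAd i hi) (hEu i hi) (hEd i hi))
  refine ⟨⟨?_, ?_, fun M hMli hMspan => ?_⟩, ?_, fun μ => ?_, rank_eq_of_mulVec_injective hlead⟩
  · exact Matrix.mulVec_injective_iff.mp 
      (Nmb_map_mulVec_injective (algebraMap ℂ[X] (RatFunc ℂ)) k hk0 t A Ehat)
  · rw [← range_Nmb_mulVecLin hk0 Ehat hAd, Matrix.range_mulVecLin]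
    rfl
  · have hM := eq_Nmb_mul_top hk0 Ehat hAd M fun j =>
      hMspan ▸ Submodule.subset_span (Set.mem_range_self j)
    rw [hM] at hMli ⊢
    exact sum_colDegree_le_mul hlead (det_ne_zero_of_linearIndependent_mul hMli)
  · refine Matrix.ext_of_mulVec_single fun j => ?_
    have h := pencilMat_bidiag_map_mulVec_Nmb (RingHom.id ℂ[X]) hk0 Ehat hAd (Pi.single j 1)
    rw [RingHom.coe_id, Matrix.map_id, Matrix.map_id] at h
    rw [← Matrix.mulVec_mulVec, h, Matrix.zero_mulVec]
  · refine rank_eq_of_mulVec_injective ?_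
    have hmap : evalMat (Nmb k t A Ehat) μ = (Nmb k t A Ehat).map (evalRingHom μ) := by
      ext; simp [evalMat]
    rw [hmap]
    exact Nmb_map_mulVec_injective (evalRingHom μ) k hk0 t A Ehat

end
end
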